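/- arXiv:2503.17556 — 3 statements merged into one kernel-verified Lean document; each statement's English description precedes it below -/
import Mathlib

section
/- Two partial permutations (I,J) and (I′,J′) in S_n (not necessarily of the same size) have the same cycle-path type if and only if there exists a permutation w ∈ S_n with I′ = w(I) and J′ = w(J), where w acts on a tuple entrywise: w((a_1,…,a_k)) = (w(a_1),…,w(a_k)). -/
open Finset Filter
open scoped Classical BigOperators

namespace PaperStmt

/-- One step of the partial injection encoded by the tuples `I`, `J`. -/
noncomputable def pstep {k : ℕ} (I J : Fin k → ℕ) (x : ℕ) : Option ℕ :=
  if h : ∃ ℓ, I ℓ = x then some (J h.choose) else none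

/-- Iterates of the partial injection encoded by `I`, `J`. -/
noncomputable def piter {k : ℕ} (I J : Fin k → ℕ) : ℕ → ℕ → Option ℕ
  | 0, x => some x
  | t + 1, x => (piter I J t x).bind (pstep I J)

/-- The vertex set of the graph `G(I,J)`. -/
def pverts {k : ℕ} (I J : Fin k → ℕ) : Finset ℕ :=
  Finset.image I Finset.univ ∪ Finset.image J Finset.univ

/-- The number of directed cycles of length `i` in the graph `G(I,J)`. -/
noncomputable def cycleMult {k : ℕ} (I J : Fin k → ℕ) (i : ℕ) : ℕ :=
  ((pverts I J).filter fun x =>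
    piter I J i x = some x ∧ ∀ t, 0 < t → t < i → piter I J t x ≠ some x).card / i

/-- The number of directed path components with exactly `ℓ` edges in `G(I,J)`. -/
noncomputable def pathMult {k : ℕ} (I J : Fin k → ℕ) (ℓ : ℕ) : ℕ :=
  ((pverts I J).filter fun x =>
    (∀ a, J a ≠ x) ∧ (piter I J ℓ x).isSome ∧ piter I J (ℓ + 1) x = none).card

/-- The cycle partition `μ` of the partial permutation `(I,J)`. -/
noncomputable def cyclePart {k : ℕ} (I J : Fin k → ℕ) : Multiset ℕ :=
  ∑ i ∈ Finset.range (k + 1), Multiset.replicate (cycleMult I J i) i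

/-- The path partition `ν` of the partial permutation `(I,J)`. -/
noncomputable def pathPart {k : ℕ} (I J : Fin k → ℕ) : Multiset ℕ :=
  ∑ i ∈ Finset.range (k + 1), Multiset.replicate (pathMult I J i) i

/-- The full cycle type of a permutation (including fixed points as parts equal to 1). -/
noncomputable def fullCycleType {n : ℕ} (π : Equiv.Perm (Fin n)) : Multiset ℕ :=
  π.cycleType + Multiset.replicate (n - π.support.card) 1

/-- The conjugacy class `K_λ` of permutations of cycle type `λ`. -/
noncomputable def KClass {n : ℕ} (lam : Nat.Partition n) : Finset (Equiv.Perm (Fin n)) :=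
  Finset.univ.filter fun π => fullCycleType π = lam.parts

/-- Expectation of a statistic over the uniform distribution on `K_λ`. -/
noncomputable def expect {n : ℕ} (lam : Nat.Partition n) (f : Equiv.Perm (Fin n) → ℝ) : ℝ :=
  (∑ π ∈ KClass lam, f π) / (KClass lam).card

/-- The indicator `1_{IJ}` of the partial permutation `(I,J)` in `S_n`. -/
noncomputable def indic {n k : ℕ} (I J : Fin k → Fin n) (π : Equiv.Perm (Fin n)) : ℝ :=
  if ∀ ℓ, π (I ℓ) = J ℓ then 1 else 0

section PartialInjection

variable {k : ℕ} {I J : Fin k → ℕ}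

lemma pstep_eq_some_iff (hI : Function.Injective I) {x y : ℕ} :
    pstep I J x = some y ↔ ∃ a, I a = x ∧ J a = y := by
  unfold pstep
  constructor
  · intro h
    split_ifs at h with hx
    exact ⟨hx.choose, hx.choose_spec, by simpa using h⟩
  · rintro ⟨a, rfl, rfl⟩
    have hx : ∃ b, I b = I a := ⟨a, rfl⟩
    rw [dif_pos hx, hI hx.choose_spec]

lemma pstep_eq_none_iff {x : ℕ} : pstep I J x = none ↔ ∀ a, I a ≠ x := by
  unfold pstep
  split_ifs with h <;> simpa using h

lemma left_mem_pverts (a : Fin k) : I a ∈ pverts I J := by simp [pverts]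

lemma right_mem_pverts (a : Fin k) : J a ∈ pverts I J := by simp [pverts]

lemma mem_pverts_iff {x : ℕ} : x ∈ pverts I J ↔ (∃ a, I a = x) ∨ ∃ a, J a = x := by
  simp [pverts]

@[simp] lemma piter_zero (x : ℕ) : piter I J 0 x = some x := rfl

lemma piter_succ (t x : ℕ) : piter I J (t + 1) x = (piter I J t x).bind (pstep I J) := rfl

lemma piter_one (x : ℕ) : piter I J 1 x = pstep I J x := rfl

lemma piter_add (s t x : ℕ) : piter I J (s + t) x = (piter I J s x).bind (piter I J t) := by
  induction t with
  | zero => simp [show piter I J 0 = some from rfl]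
  | succ t ih =>
    rw [← add_assoc, piter_succ, ih, Option.bind_assoc]
    rfl

lemma piter_add_of_eq {s x y : ℕ} (h : piter I J s x = some y) (t : ℕ) :
    piter I J (s + t) x = piter I J t y := by
  rw [piter_add, h]; rfl

lemma exists_of_piter_add {s t x z : ℕ} (h : piter I J (s + t) x = some z) :
    ∃ y, piter I J s x = some y ∧ piter I J t y = some z := by
  rw [piter_add] at h
  exact Option.bind_eq_some_iff.1 h

lemma piter_inj (hI : Function.Injective I) (hJ : Function.Injective J) {t x y z : ℕ}
    (hx : piter I J t x = some z) (hy : piter I J t y = some z) : x = y := by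
  induction t generalizing z with
  | zero => simp_all
  | succ t ih =>
    obtain ⟨u, hu, hu'⟩ := exists_of_piter_add hx
    obtain ⟨v, hv, hv'⟩ := exists_of_piter_add hy
    rw [piter_one, pstep_eq_some_iff hI] at hu' hv'
    obtain ⟨a, rfl, rfl⟩ := hu'
    obtain ⟨b, rfl, hb⟩ := hv'
    obtain rfl := hJ hb
    exact ih hu hv

lemma exists_right_of_piter_succ (hI : Function.Injective I) {t x y : ℕ}
    (h : piter I J (t + 1) x = some y) : ∃ a, J a = y := by
  obtain ⟨u, -, hu⟩ := exists_of_piter_add h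
  obtain ⟨a, -, ha⟩ := (pstep_eq_some_iff hI).1 hu
  exact ⟨a, ha⟩

lemma piter_mem_pverts (hI : Function.Injective I) {t x y : ℕ} (hx : x ∈ pverts I J)
    (h : piter I J t x = some y) : y ∈ pverts I J := by
  cases t with
  | zero => simp_all
  | succ t =>
    obtain ⟨a, rfl⟩ := exists_right_of_piter_succ hI h
    exact right_mem_pverts a

lemma mem_pverts_of_piter (hI : Function.Injective I) {t x y : ℕ} (hy : y ∈ pverts I J)
    (h : piter I J t x = some y) : x ∈ pverts I J := by
  cases t with
  | zero => simp_all
  | succ t =>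
    rw [add_comm] at h
    obtain ⟨u, hu, -⟩ := exists_of_piter_add h
    obtain ⟨a, rfl, -⟩ := (pstep_eq_some_iff hI).1 hu
    exact left_mem_pverts a

/-- The starting point of a path and the distance to it are determined by any vertex. -/
lemma source_unique (hI : Function.Injective I) (hJ : Function.Injective J) {d d' r r' z : ℕ}
    (hr : ∀ a, J a ≠ r) (hr' : ∀ a, J a ≠ r')
    (h : piter I J d r = some z) (h' : piter I J d' r' = some z) : d = d' ∧ r = r' := by
  wlog hd : d ≤ d' generalizing d d' r r'
  · obtain ⟨h1, h2⟩ := this hr' hr h' h (by omega)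
    exact ⟨h1.symm, h2.symm⟩
  obtain ⟨e, rfl⟩ := Nat.exists_eq_add_of_le' hd
  obtain ⟨u, hu, hu'⟩ := exists_of_piter_add h'
  obtain rfl := piter_inj hI hJ hu' h
  cases e with
  | zero => simp_all
  | succ e =>
    obtain ⟨a, ha⟩ := exists_right_of_piter_succ hI hu
    exact absurd ha (hr a)

/-- Every vertex lies on a path with a source or on a cycle. -/
lemma exists_source_or_periodic (hI : Function.Injective I) {x : ℕ}
    (hx : x ∈ pverts I J) :
    (∃ r d, (∀ a, J a ≠ r) ∧ piter I J d r = some x) ∨ ∃ m, 0 < m ∧ piter I J m x = some x := by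
  by_contra! hcon
  obtain ⟨h1, h2⟩ := hcon
  have back : ∀ d, ∃ y, piter I J d y = some x := by
    intro d
    induction d with
    | zero => exact ⟨x, rfl⟩
    | succ d ih =>
      obtain ⟨y, hy⟩ := ih
      by_cases hs : ∀ a, J a ≠ y
      · exact absurd hy (h1 y d hs)
      · push Not at hs
        obtain ⟨a, rfl⟩ := hs
        refine ⟨I a, ?_⟩
        rw [add_comm, piter_add_of_eq (y := J a) _ d, hy]
        exact (pstep_eq_some_iff hI).2 ⟨a, rfl, rfl⟩
  choose y hy using back
  have hmem : ∀ d, y d ∈ pverts I J := fun d => mem_pverts_of_piter hI hx (hy d)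
  obtain ⟨d, e, hde, heq⟩ := Finite.exists_ne_map_eq_of_infinite
    (fun d => (⟨y d, hmem d⟩ : {z // z ∈ pverts I J}))
  simp only [Subtype.mk.injEq] at heq
  wlog hlt : d < e generalizing d e
  · exact this e d hde.symm heq.symm (by omega)
  obtain ⟨m, rfl⟩ := Nat.exists_eq_add_of_lt hlt
  refine h2 (m + 1) (by omega) ?_
  rw [← piter_add_of_eq (hy d) (m + 1), heq]
  exact hy _

/-- A path starting at a source has a last vertex. -/
lemma exists_path_length (hI : Function.Injective I) (hJ : Function.Injective J) {r : ℕ}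
    (hrv : r ∈ pverts I J) (hr : ∀ a, J a ≠ r) :
    ∃ l, (piter I J l r).isSome ∧ piter I J (l + 1) r = none := by
  by_contra! hcon
  have hall : ∀ d, (piter I J d r).isSome := by
    intro d
    induction d with
    | zero => rfl
    | succ d ih => exact Option.isSome_iff_ne_none.2 (hcon d ih)
  choose y hy using fun d => Option.isSome_iff_exists.1 (hall d)
  obtain ⟨d, e, hde, heq⟩ := Finite.exists_ne_map_eq_of_infinite
    (fun d => (⟨y d, piter_mem_pverts hI hrv (hy d)⟩ : {z // z ∈ pverts I J}))
  simp only [Subtype.mk.injEq] at heq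
  exact hde (source_unique hI hJ hr hr (hy d) (heq ▸ hy e)).1

lemma isSome_piter_of_le {s t x : ℕ} (hst : s ≤ t) (h : (piter I J t x).isSome) :
    (piter I J s x).isSome := by
  obtain ⟨e, rfl⟩ := Nat.exists_eq_add_of_le hst
  obtain ⟨z, hz⟩ := Option.isSome_iff_exists.1 h
  obtain ⟨y, hy, -⟩ := exists_of_piter_add hz
  simp [hy]

/-- `x` lies on a cycle of length `i` (for `0 < i`). -/
def IsCyclic {k : ℕ} (I J : Fin k → ℕ) (i x : ℕ) : Prop :=
  piter I J i x = some x ∧ ∀ t, 0 < t → t < i → piter I J t x ≠ some x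

/-- `x` is the source of a path with `l` edges. -/
def IsSource {k : ℕ} (I J : Fin k → ℕ) (l x : ℕ) : Prop :=
  (∀ a, J a ≠ x) ∧ (piter I J l x).isSome ∧ piter I J (l + 1) x = none

/-- `x` is the least vertex among those reachable from it. -/
def IsLeastInOrbit {k : ℕ} (I J : Fin k → ℕ) (x : ℕ) : Prop :=
  ∀ t y, piter I J t x = some y → x ≤ y

lemma IsSource.length_unique {l l' x : ℕ} (h : IsSource I J l x) (h' : IsSource I J l' x) :
    l = l' := by
  by_contra hne
  wlog hlt : l < l' generalizing l l'
  · exact this h' h (Ne.symm hne) (by omega)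
  have := isSome_piter_of_le (s := l + 1) hlt h'.2.1
  simp [h.2.2] at this

lemma IsCyclic.length_unique {i i' x : ℕ} (hi : 0 < i) (hi' : 0 < i') (h : IsCyclic I J i x)
    (h' : IsCyclic I J i' x) : i = i' := by
  by_contra hne
  wlog hlt : i < i' generalizing i i'
  · exact this hi' hi h' h (Ne.symm hne) (by omega)
  exact h'.2 i hi hlt h.1

lemma exists_isCyclic {m x : ℕ} (hm : 0 < m) (h : piter I J m x = some x) :
    ∃ i, 0 < i ∧ IsCyclic I J i x := by
  have hex : ∃ m, 0 < m ∧ piter I J m x = some x := ⟨m, hm, h⟩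
  exact ⟨Nat.find hex, (Nat.find_spec hex).1, (Nat.find_spec hex).2,
    fun t ht hlt heq => Nat.find_min hex hlt ⟨ht, heq⟩⟩

lemma piter_mul {i x : ℕ} (h : piter I J i x = some x) (q : ℕ) :
    piter I J (i * q) x = some x := by
  induction q with
  | zero => rfl
  | succ q ih => rw [Nat.mul_succ, piter_add_of_eq ih, h]

lemma piter_mod {i x : ℕ} (h : piter I J i x = some x) (t : ℕ) :
    piter I J (t % i) x = piter I J t x := by
  conv_rhs => rw [← Nat.div_add_mod t i, piter_add_of_eq (piter_mul h _)]

lemma IsCyclic.piter (hI : Function.Injective I) (hJ : Function.Injective J) {i t x y : ℕ}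
    (h : IsCyclic I J i x) (hy : piter I J t x = some y) : IsCyclic I J i y := by
  refine ⟨?_, fun s hs hsi heq => h.2 s hs hsi ?_⟩
  · rw [← piter_add_of_eq hy, add_comm, piter_add_of_eq h.1, hy]
  · rw [← piter_add_of_eq hy, add_comm] at heq
    obtain ⟨u, hu, hu'⟩ := exists_of_piter_add heq
    rw [hu, piter_inj hI hJ hu' hy]

lemma IsCyclic.exists_return {i t x y : ℕ} (hi : 0 < i) (h : IsCyclic I J i x)
    (hy : PaperStmt.piter I J t x = some y) : ∃ s, PaperStmt.piter I J s y = some x := by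
  obtain ⟨s, hs⟩ := Nat.exists_eq_add_of_le (Nat.le_mul_of_pos_left t hi)
  exact ⟨s, by rw [← piter_add_of_eq hy, ← hs, piter_mul h.1]⟩

lemma IsCyclic.piter_injective (hI : Function.Injective I) (hJ : Function.Injective J)
    {i d d' x z : ℕ} (h : IsCyclic I J i x) (hd : d < i) (hd' : d' < i)
    (hz : PaperStmt.piter I J d x = some z) (hz' : PaperStmt.piter I J d' x = some z) :
    d = d' := by
  by_contra hne
  wlog hlt : d < d' generalizing d d'
  · exact this hd' hd hz' hz (Ne.symm hne) (by omega)
  obtain ⟨e, rfl⟩ := Nat.exists_eq_add_of_le' hlt.le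
  obtain ⟨u, hu, hu'⟩ := exists_of_piter_add hz'
  obtain rfl := piter_inj hI hJ hu' hz
  exact h.2 e (by omega) (by omega) hu

lemma IsCyclic.exists_isLeastInOrbit (hI : Function.Injective I) (hJ : Function.Injective J) {i x : ℕ}
    (hi : 0 < i) (h : IsCyclic I J i x) :
    ∃ r d, d < i ∧ IsCyclic I J i r ∧ IsLeastInOrbit I J r ∧ PaperStmt.piter I J d r = some x := by
  have hex : ∃ y t, PaperStmt.piter I J t x = some y := ⟨x, 0, rfl⟩
  obtain ⟨t, ht⟩ := Nat.find_spec hex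
  have hc := h.piter hI hJ ht
  obtain ⟨s, hs⟩ := h.exists_return hi ht
  refine ⟨Nat.find hex, s % i, Nat.mod_lt _ hi, hc, fun u y hy => ?_, by rw [piter_mod hc.1, hs]⟩
  exact Nat.find_min' hex ⟨t + u, by rw [piter_add_of_eq ht, hy]⟩

lemma least_unique (hI : Function.Injective I) (hJ : Function.Injective J)
    {i i' d d' r r' z : ℕ} (hi : 0 < i) (hi' : 0 < i') (hr : IsCyclic I J i r)
    (hr' : IsCyclic I J i' r') (hm : IsLeastInOrbit I J r) (hm' : IsLeastInOrbit I J r')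
    (hd : d < i) (hd' : d' < i') (h : piter I J d r = some z) (h' : piter I J d' r' = some z) :
    i = i' ∧ d = d' ∧ r = r' := by
  obtain rfl := (hr.piter hI hJ h).length_unique hi hi' (hr'.piter hI hJ h')
  obtain ⟨s, hs⟩ := hr.exists_return hi h
  obtain ⟨s', hs'⟩ := hr'.exists_return hi h'
  have h1 : r' ≤ r := hm' (d' + s) r (by rw [piter_add_of_eq h', hs])
  have h2 : r ≤ r' := hm (d + s') r' (by rw [piter_add_of_eq h, hs'])
  obtain rfl := le_antisymm h2 h1
  exact ⟨rfl, hr.piter_injective hI hJ hd hd' h h', rfl⟩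

/-- The least vertices of the cycles of length `i`. -/
noncomputable def cycleRoots {k : ℕ} (I J : Fin k → ℕ) (i : ℕ) : Finset ℕ :=
  (pverts I J).filter fun x => IsCyclic I J i x ∧ IsLeastInOrbit I J x

lemma cycleMult_eq_card_cycleRoots (hI : Function.Injective I) (hJ : Function.Injective J)
    {i : ℕ} (hi : 0 < i) : cycleMult I J i = (cycleRoots I J i).card := by
  have key : ((pverts I J).filter fun x => IsCyclic I J i x).card =
      (cycleRoots I J i ×ˢ range i).card := by
    symm
    refine Finset.card_bij (fun p _ => (piter I J p.2 p.1).getD 0) ?_ ?_ ?_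
    all_goals simp only [cycleRoots, mem_product, mem_filter, mem_range, Prod.forall, Prod.exists]
    · rintro r d ⟨⟨hv, hc, -⟩, hd⟩
      obtain ⟨z, hz⟩ := Option.isSome_iff_exists.1
        (isSome_piter_of_le hd.le (by rw [hc.1]; rfl))
      rw [hz]
      exact ⟨piter_mem_pverts hI hv hz, hc.piter hI hJ hz⟩
    · rintro r d ⟨⟨hv, hc, hm⟩, hd⟩ r' d' ⟨⟨hv', hc', hm'⟩, hd'⟩ heq
      obtain ⟨z, hz⟩ := Option.isSome_iff_exists.1
        (isSome_piter_of_le hd.le (by rw [hc.1]; rfl))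
      obtain ⟨z', hz'⟩ := Option.isSome_iff_exists.1
        (isSome_piter_of_le hd'.le (by rw [hc'.1]; rfl))
      change (piter I J d r).getD 0 = (piter I J d' r').getD 0 at heq
      rw [hz, hz'] at heq
      change z = z' at heq
      subst heq
      obtain ⟨-, rfl, rfl⟩ := least_unique hI hJ hi hi hc hc' hm hm' hd hd' hz hz'
      rfl
    · rintro x ⟨hv, hc⟩
      obtain ⟨r, d, hd, hr, hm, hx⟩ := hc.exists_isLeastInOrbit hI hJ hi
      exact ⟨r, d, ⟨⟨mem_pverts_of_piter hI hv hx, hr, hm⟩, hd⟩, by simp [hx]⟩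
  have : cycleMult I J i = ((pverts I J).filter fun x => IsCyclic I J i x).card / i := by
    unfold cycleMult IsCyclic
    congr!
  rw [this, key, card_product, card_range, Nat.mul_div_cancel _ hi]

lemma pathMult_eq_card (l : ℕ) :
    pathMult I J l = ((pverts I J).filter fun x => IsSource I J l x).card := by
  unfold pathMult IsSource
  congr!

end PartialInjection

/-- The vertices of a disjoint union of `c i` directed cycles of length `i + 1` and `p l` directed
paths with `l` edges. -/
abbrev Model (c p : ℕ → ℕ) : Type :=
  (Σ i : ℕ, Fin (c i) × Fin (i + 1)) ⊕ (Σ l : ℕ, Fin (p l) × Fin (l + 1))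

/-- The successor of a vertex of `Model c p`. -/
def Model.step {c p : ℕ → ℕ} : Model c p → Option (Model c p)
  | .inl ⟨i, a, d⟩ => some (.inl ⟨i, a, d + 1⟩)
  | .inr ⟨l, a, d⟩ =>
    if h : (d : ℕ) + 1 < l + 1 then some (.inr ⟨l, a, ⟨d + 1, h⟩⟩) else none

/-- The graph of a partial injection is determined by the multiplicities of its cycles and
paths. -/
theorem exists_model {k : ℕ} {I J : Fin k → ℕ} (hI : Function.Injective I)
    (hJ : Function.Injective J) :
    ∃ Φ : Model (fun i => cycleMult I J (i + 1)) (pathMult I J) → ℕ,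
      Function.Injective Φ ∧ (∀ x, x ∈ pverts I J ↔ ∃ m, Φ m = x) ∧
      ∀ m, pstep I J (Φ m) = m.step.map Φ := by
  let A : (i : ℕ) → Fin (cycleMult I J (i + 1)) ≃ cycleRoots I J (i + 1) := fun i =>
    (Finset.equivFinOfCardEq (cycleMult_eq_card_cycleRoots hI hJ i.succ_pos).symm).symm
  let B : (l : ℕ) → Fin (pathMult I J l) ≃
      {x // x ∈ (pverts I J).filter fun x => IsSource I J l x} := fun l =>
    (Finset.equivFinOfCardEq (pathMult_eq_card l).symm).symm
  have hA : ∀ i a, (A i a : ℕ) ∈ pverts I J ∧ IsCyclic I J (i + 1) (A i a) ∧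
      IsLeastInOrbit I J (A i a) := fun i a => mem_filter.1 (A i a).2
  have hB : ∀ l a, (B l a : ℕ) ∈ pverts I J ∧ IsSource I J l (B l a) := fun l a =>
    mem_filter.1 (B l a).2
  let Φ : Model (fun i => cycleMult I J (i + 1)) (pathMult I J) → ℕ
    | .inl ⟨i, a, d⟩ => (piter I J d (A i a)).getD 0
    | .inr ⟨l, a, d⟩ => (piter I J d (B l a)).getD 0
  have hΦl : ∀ i a d, piter I J (d : Fin (i + 1)) (A i a) = some (Φ (.inl ⟨i, a, d⟩)) := by
    intro i a d
    obtain ⟨z, hz⟩ := Option.isSome_iff_exists.1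
      (isSome_piter_of_le d.2.le (by rw [(hA i a).2.1.1]; rfl))
    simp [Φ, hz]
  have hΦr : ∀ l a d, piter I J (d : Fin (l + 1)) (B l a) = some (Φ (.inr ⟨l, a, d⟩)) := by
    intro l a d
    obtain ⟨z, hz⟩ := Option.isSome_iff_exists.1
      (isSome_piter_of_le (Nat.le_of_lt_succ d.2) (hB l a).2.2.1)
    simp [Φ, hz]
  have hdisj : ∀ i a d l b e, Φ (.inl ⟨i, a, d⟩) ≠ Φ (.inr ⟨l, b, e⟩) := by
    intro i a d l b e heq
    have h1 := hΦl i a d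
    have h2 := hΦr l b e
    rw [← heq] at h2
    have hc := (hA i a).2.1.piter hI hJ h1
    have h3 := piter_add_of_eq h2 (i + 1)
    rw [hc.1] at h3
    have := (source_unique hI hJ (hB l b).2.1 (hB l b).2.1 h3 h2).1
    omega
  refine ⟨Φ, ?_, ?_, ?_⟩
  · rintro (⟨i, a, d⟩ | ⟨l, a, d⟩) (⟨i', a', d'⟩ | ⟨l', a', d'⟩) heq
    · have h1 := hΦl i a d
      have h2 := hΦl i' a' d'
      rw [← heq] at h2
      obtain ⟨hi, hd, hr⟩ := least_unique hI hJ i.succ_pos i'.succ_pos (hA i a).2.1 (hA i' a').2.1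
        (hA i a).2.2 (hA i' a').2.2 d.2 d'.2 h1 h2
      obtain rfl : i = i' := by omega
      obtain rfl := Fin.ext hd
      obtain rfl := (A i).injective (Subtype.ext hr)
      rfl
    · exact absurd heq (hdisj _ _ _ _ _ _)
    · exact absurd heq.symm (hdisj _ _ _ _ _ _)
    · have h1 := hΦr l a d
      have h2 := hΦr l' a' d'
      rw [← heq] at h2
      obtain ⟨hd, hr⟩ := source_unique hI hJ (hB l a).2.1 (hB l' a').2.1 h1 h2
      obtain rfl : l = l' := (hB l a).2.length_unique (hr ▸ (hB l' a').2)
      obtain rfl := Fin.ext hd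
      obtain rfl := (B l).injective (Subtype.ext hr)
      rfl
  · intro x
    constructor
    · intro hx
      rcases exists_source_or_periodic hI hx with ⟨r, d, hr, hd⟩ | ⟨m, hm, hmx⟩
      · have hrv := mem_pverts_of_piter hI hx hd
        obtain ⟨l, hl, hl'⟩ := exists_path_length hI hJ hrv hr
        have hdl : d < l + 1 := by
          by_contra! hle
          have := isSome_piter_of_le (I := I) (J := J) (x := r) hle (by simp [hd])
          simp [hl'] at this
        refine ⟨.inr ⟨l, (B l).symm ⟨r, mem_filter.2 ⟨hrv, hr, hl, hl'⟩⟩, ⟨d, hdl⟩⟩, ?_⟩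
        simp [Φ, hd]
      · obtain ⟨i, hi, hc⟩ := exists_isCyclic hm hmx
        obtain ⟨r, d, hd, hr, hm, hdx⟩ := hc.exists_isLeastInOrbit hI hJ hi
        obtain ⟨i, rfl⟩ := Nat.exists_eq_succ_of_ne_zero hi.ne'
        refine ⟨.inl ⟨i, (A i).symm ⟨r, mem_filter.2
          ⟨mem_pverts_of_piter hI hx hdx, hr, hm⟩⟩, ⟨d, hd⟩⟩, ?_⟩
        simp [Φ, hdx]
    · rintro ⟨⟨i, a, d⟩ | ⟨l, a, d⟩, rfl⟩
      · exact piter_mem_pverts hI (hA i a).1 (hΦl i a d)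
      · exact piter_mem_pverts hI (hB l a).1 (hΦr l a d)
  · rintro (⟨i, a, d⟩ | ⟨l, a, d⟩)
    · have h1 := piter_add_of_eq (hΦl i a d) 1
      rw [piter_one] at h1
      rw [← h1, ← piter_mod (hA i a).2.1.1]
      have h3 : ((d : ℕ) + 1) % (i + 1) = ((d + 1 : Fin (i + 1)) : ℕ) := by
        rw [Fin.val_add]; simp
      rw [h3]
      exact hΦl i a (d + 1)
    · have h1 := piter_add_of_eq (hΦr l a d) 1
      rw [piter_one] at h1
      rw [← h1]
      by_cases h : (d : ℕ) + 1 < l + 1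
      · simpa [Model.step, h] using hΦr l a ⟨d + 1, h⟩
      · have hd : (d : ℕ) = l := by have := d.2; omega
        rw [hd]
        simpa [Model.step, h] using (hB l a).2.2.2

section Multiplicities

variable {k : ℕ} {I J : Fin k → ℕ}

lemma exists_left_of_step {c p : ℕ → ℕ} {Φ : Model c p → ℕ}
    (hΦ : ∀ m, pstep I J (Φ m) = m.step.map Φ) {m : Model c p} (hm : m.step.isSome) :
    ∃ a, I a = Φ m := by
  by_contra! h
  have := hΦ m
  rw [pstep_eq_none_iff.2 h] at this
  simp at this
  simp [this] at hm

lemma cycleMult_eq_zero (hI : Function.Injective I) (hJ : Function.Injective J) {i : ℕ}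
    (hi : k < i) : cycleMult I J i = 0 := by
  obtain ⟨i, rfl⟩ := Nat.exists_eq_succ_of_ne_zero (by omega : i ≠ 0)
  by_contra hne
  obtain ⟨Φ, hinj, -, hΦ⟩ := exists_model hI hJ
  have h : ∀ d : Fin (i + 1), ∃ a, I a = Φ (.inl ⟨i, ⟨0, Nat.pos_of_ne_zero hne⟩, d⟩) :=
    fun d => exists_left_of_step hΦ rfl
  choose a ha using h
  have : Function.Injective a := by
    intro d d' hd
    have := hinj ((ha d).symm.trans ((congrArg I hd).trans (ha d')))
    simpa using this
  have := Fintype.card_le_of_injective a this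
  simp at this
  omega

lemma pathMult_eq_zero (hI : Function.Injective I) (hJ : Function.Injective J) {l : ℕ}
    (hl : k < l) : pathMult I J l = 0 := by
  by_contra hne
  obtain ⟨Φ, hinj, -, hΦ⟩ := exists_model hI hJ
  have h : ∀ d : Fin l, ∃ a, I a = Φ (.inr ⟨l, ⟨0, Nat.pos_of_ne_zero hne⟩, d.castSucc⟩) :=
    fun d => exists_left_of_step hΦ (by simp [Model.step])
  choose a ha using h
  have : Function.Injective a := by
    intro d d' hd
    have := hinj ((ha d).symm.trans ((congrArg I hd).trans (ha d')))
    simpa using this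
  have := Fintype.card_le_of_injective a this
  simp at this
  omega

lemma count_sum_replicate (f : ℕ → ℕ) (N i : ℕ) :
    Multiset.count i (∑ j ∈ Finset.range N, Multiset.replicate (f j) j) =
      if i < N then f i else 0 := by
  simp [Multiset.count_sum', Multiset.count_replicate]

lemma count_cyclePart (hI : Function.Injective I) (hJ : Function.Injective J) (i : ℕ) :
    Multiset.count i (cyclePart I J) = cycleMult I J i := by
  rw [cyclePart, count_sum_replicate]
  split_ifs with h
  · rfl
  · exact (cycleMult_eq_zero hI hJ (by omega)).symm

lemma count_pathPart (hI : Function.Injective I) (hJ : Function.Injective J) (l : ℕ) :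
    Multiset.count l (pathPart I J) = pathMult I J l := by
  rw [pathPart, count_sum_replicate]
  split_ifs with h
  · rfl
  · exact (pathMult_eq_zero hI hJ (by omega)).symm

end Multiplicities

section Invariance

variable {k : ℕ} {I J I' J' : Fin k → ℕ} {W : Equiv.Perm ℕ} {e : Fin k ≃ Fin k}

lemma pstep_conj (hI : Function.Injective I) (hI' : Function.Injective I')
    (h1 : ∀ a, I' a = W (I (e a))) (h2 : ∀ a, J' a = W (J (e a))) (x : ℕ) :
    pstep I' J' (W x) = (pstep I J x).map W := by
  cases h : pstep I J x with
  | none =>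
    rw [pstep_eq_none_iff] at h
    rw [Option.map_none, pstep_eq_none_iff]
    intro a ha
    rw [h1] at ha
    exact h _ (W.injective ha)
  | some y =>
    obtain ⟨a, rfl, rfl⟩ := (pstep_eq_some_iff hI).1 h
    rw [Option.map_some, pstep_eq_some_iff hI']
    exact ⟨e.symm a, by simp [h1], by simp [h2]⟩

lemma piter_conj (hI : Function.Injective I) (hI' : Function.Injective I')
    (h1 : ∀ a, I' a = W (I (e a))) (h2 : ∀ a, J' a = W (J (e a))) (t x : ℕ) :
    piter I' J' t (W x) = (piter I J t x).map W := by
  induction t with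
  | zero => rfl
  | succ t ih =>
    rw [piter_succ, piter_succ, ih]
    cases piter I J t x with
    | none => rfl
    | some y => exact pstep_conj hI hI' h1 h2 y

lemma mem_pverts_conj (h1 : ∀ a, I' a = W (I (e a))) (h2 : ∀ a, J' a = W (J (e a))) (x : ℕ) :
    x ∈ pverts I J ↔ W x ∈ pverts I' J' := by
  simp only [mem_pverts_iff, h1, h2, W.injective.eq_iff]
  rw [e.surjective.exists, e.surjective.exists (p := fun a => J a = x)]

lemma cycleMult_conj (hI : Function.Injective I) (hI' : Function.Injective I')
    (h1 : ∀ a, I' a = W (I (e a))) (h2 : ∀ a, J' a = W (J (e a))) :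
    cycleMult I J = cycleMult I' J' := by
  funext i
  unfold cycleMult
  congr 1
  refine Finset.card_equiv W fun x => ?_
  have hs : ∀ t, piter I' J' t (W x) = some (W x) ↔ piter I J t x = some x := fun t => by
    rw [piter_conj hI hI' h1 h2, ← Option.map_some, (Option.map_injective W.injective).eq_iff]
  simp only [mem_filter, mem_pverts_conj h1 h2, hs, ne_eq]

lemma pathMult_conj (hI : Function.Injective I) (hI' : Function.Injective I')
    (h1 : ∀ a, I' a = W (I (e a))) (h2 : ∀ a, J' a = W (J (e a))) :
    pathMult I J = pathMult I' J' := by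
  funext l
  unfold pathMult
  refine Finset.card_equiv W fun x => ?_
  simp only [mem_filter, mem_pverts_conj h1 h2, piter_conj hI hI' h1 h2, Option.isSome_map,
    Option.map_eq_none_iff, h2, ne_eq, W.injective.eq_iff]
  rw [e.surjective.forall]

end Invariance

/-- Partial injections with the same multiplicities of cycles and of paths are isomorphic on
their vertices. -/
lemma exists_equiv_pverts {k k' : ℕ} {I J : Fin k → ℕ} {I' J' : Fin k' → ℕ}
    (hI : Function.Injective I) (hJ : Function.Injective J)
    (hI' : Function.Injective I') (hJ' : Function.Injective J')
    (hc : cycleMult I J = cycleMult I' J') (hp : pathMult I J = pathMult I' J') :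
    ∃ w : {x // x ∈ pverts I J} ≃ {x // x ∈ pverts I' J'},
      ∀ x y : {x // x ∈ pverts I J}, pstep I J x = some (y : ℕ) ↔ pstep I' J' (w x) = some (w y : ℕ) := by
  obtain ⟨Φ, hinj, hran, hΦ⟩ := exists_model hI hJ
  have hmodel := exists_model hI' hJ'
  rw [← hc, ← hp] at hmodel
  obtain ⟨Ψ, hinj', hran', hΨ⟩ := hmodel
  let E := Equiv.ofBijective (fun m => (⟨Φ m, (hran _).2 ⟨m, rfl⟩⟩ : {x // x ∈ pverts I J}))
    ⟨fun m m' h => hinj (congrArg Subtype.val h),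
      fun x => ((hran x).1 x.2).imp fun m hm => Subtype.ext hm⟩
  let E' := Equiv.ofBijective (fun m => (⟨Ψ m, (hran' _).2 ⟨m, rfl⟩⟩ : {x // x ∈ pverts I' J'}))
    ⟨fun m m' h => hinj' (congrArg Subtype.val h),
      fun x => ((hran' x).1 x.2).imp fun m hm => Subtype.ext hm⟩
  refine ⟨E.symm.trans E', fun x y => ?_⟩
  obtain ⟨m, rfl⟩ := E.surjective x
  obtain ⟨m', rfl⟩ := E.surjective y
  simp only [Equiv.trans_apply, Equiv.symm_apply_apply]
  change pstep I J (Φ m) = some (Φ m') ↔ pstep I' J' (Ψ m) = some (Ψ m')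
  rw [hΦ, hΨ, ← Option.map_some, ← Option.map_some, (Option.map_injective hinj).eq_iff,
    (Option.map_injective hinj').eq_iff]

/-- An isomorphism between the vertices of two partial permutations of `Fin n` extends to a
permutation of `Fin n`. -/
lemma exists_perm_of_mult_eq {n k k' : ℕ} {I J : Fin k → Fin n} {I' J' : Fin k' → Fin n}
    (hI : Function.Injective I) (hJ : Function.Injective J)
    (hI' : Function.Injective I') (hJ' : Function.Injective J')
    (hc : cycleMult (fun a => (I a : ℕ)) (fun a => (J a : ℕ)) =
      cycleMult (fun a => (I' a : ℕ)) (fun a => (J' a : ℕ)))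
    (hp : pathMult (fun a => (I a : ℕ)) (fun a => (J a : ℕ)) =
      pathMult (fun a => (I' a : ℕ)) (fun a => (J' a : ℕ))) :
    ∃ w : Equiv.Perm (Fin n),
      (∀ a, ∃ b, I' b = w (I a) ∧ J' b = w (J a)) ∧
      ∀ b, ∃ a, I' b = w (I a) ∧ J' b = w (J a) := by
  have vI : Function.Injective fun a => (I a : ℕ) := Fin.val_injective.comp hI
  have vI' : Function.Injective fun a => (I' a : ℕ) := Fin.val_injective.comp hI'
  have vJ : Function.Injective fun a => (J a : ℕ) := Fin.val_injective.comp hJ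
  have vJ' : Function.Injective fun a => (J' a : ℕ) := Fin.val_injective.comp hJ'
  obtain ⟨w, hw⟩ := exists_equiv_pverts vI vJ vI' vJ' hc hp
  have hlt : ∀ {m : ℕ} {A B : Fin m → Fin n} {x : ℕ},
      x ∈ pverts (fun a => (A a : ℕ)) (fun a => (B a : ℕ)) → x < n := by
    intro m A B x hx
    rcases mem_pverts_iff.1 hx with ⟨a, rfl⟩ | ⟨a, rfl⟩
    exacts [(A a).2, (B a).2]
  let lift : ∀ {m : ℕ} (A B : Fin m → Fin n),
      {x // x ∈ pverts (fun a => (A a : ℕ)) (fun a => (B a : ℕ))} ≃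
      {x : Fin n // (x : ℕ) ∈ pverts (fun a => (A a : ℕ)) (fun a => (B a : ℕ))} := fun A B =>
    { toFun := fun x => ⟨⟨x, hlt x.2⟩, x.2⟩
      invFun := fun x => ⟨x, x.2⟩
      left_inv := fun _ => rfl
      right_inv := fun _ => rfl }
  let v := ((lift I J).symm.trans w).trans (lift I' J')
  have hv : ∀ (x : Fin n) (hx : (x : ℕ) ∈ pverts (fun a => (I a : ℕ)) (fun a => (J a : ℕ))),
      (v.extendSubtype x : ℕ) = w ⟨x, hx⟩ := fun x hx => by
    rw [Equiv.extendSubtype_apply_of_mem v x hx]; rfl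
  refine ⟨v.extendSubtype, fun a => ?_, fun b => ?_⟩
  · have h := (hw ⟨I a, left_mem_pverts a⟩ ⟨J a, right_mem_pverts a⟩).1
      ((pstep_eq_some_iff vI).2 ⟨a, rfl, rfl⟩)
    obtain ⟨b, h1, h2⟩ := (pstep_eq_some_iff vI').1 h
    exact ⟨b, Fin.ext (h1.trans (hv _ _).symm), Fin.ext (h2.trans (hv _ _).symm)⟩
  · obtain ⟨x, hx⟩ := w.surjective ⟨I' b, left_mem_pverts b⟩
    obtain ⟨y, hy⟩ := w.surjective ⟨J' b, right_mem_pverts b⟩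
    have h := (hw x y).2 (by rw [hx, hy]; exact (pstep_eq_some_iff vI').2 ⟨b, rfl, rfl⟩)
    obtain ⟨a, h1, h2⟩ := (pstep_eq_some_iff vI).1 h
    obtain rfl : x = ⟨I a, left_mem_pverts a⟩ := Subtype.ext h1.symm
    obtain rfl : y = ⟨J a, right_mem_pverts a⟩ := Subtype.ext h2.symm
    refine ⟨a, Fin.ext ?_, Fin.ext ?_⟩
    · rw [hv _ (left_mem_pverts a), hx]
    · rw [hv _ (right_mem_pverts a), hy]

/-- Proposition `p:cycle-path`.  Two partial permutations `(I,J)`, `(I',J')`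
in `S_n` (not necessarily of the same size) have the same cycle–path type iff there is
`w ∈ S_n` carrying one to the other entrywise (up to a simultaneous re-indexing of the pairs,
since a partial permutation is unchanged when the entries of `I` and `J` are permuted
simultaneously). -/
theorem statement1 {n k k' : ℕ} (I J : Fin k → Fin n) (I' J' : Fin k' → Fin n)
    (hI : Function.Injective I) (hJ : Function.Injective J)
    (hI' : Function.Injective I') (hJ' : Function.Injective J') :
    (cyclePart (fun ℓ => (I ℓ : ℕ)) (fun ℓ => (J ℓ : ℕ)) =
        cyclePart (fun ℓ => (I' ℓ : ℕ)) (fun ℓ => (J' ℓ : ℕ)) ∧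
      pathPart (fun ℓ => (I ℓ : ℕ)) (fun ℓ => (J ℓ : ℕ)) =
        pathPart (fun ℓ => (I' ℓ : ℕ)) (fun ℓ => (J' ℓ : ℕ))) ↔
    ∃ (w : Equiv.Perm (Fin n)) (e : Fin k' ≃ Fin k),
      (∀ ℓ, I' ℓ = w (I (e ℓ))) ∧ (∀ ℓ, J' ℓ = w (J (e ℓ))) := by
  have vI : Function.Injective fun a => (I a : ℕ) := Fin.val_injective.comp hI
  have vI' : Function.Injective fun a => (I' a : ℕ) := Fin.val_injective.comp hI'
  have vJ : Function.Injective fun a => (J a : ℕ) := Fin.val_injective.comp hJ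
  have vJ' : Function.Injective fun a => (J' a : ℕ) := Fin.val_injective.comp hJ'
  constructor
  · rintro ⟨hc, hp⟩
    obtain ⟨w, hw, hw'⟩ := exists_perm_of_mult_eq hI hJ hI' hJ'
      (funext fun i => (count_cyclePart vI vJ i).symm.trans
        ((congrArg _ hc).trans (count_cyclePart vI' vJ' i)))
      (funext fun l => (count_pathPart vI vJ l).symm.trans
        ((congrArg _ hp).trans (count_pathPart vI' vJ' l)))
    choose e he using hw'
    have hbij : Function.Bijective e := by
      refine ⟨fun b b' h => hI' ?_, fun a => ?_⟩
      · rw [(he b).1, (he b').1, h]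
      · obtain ⟨b, hb, -⟩ := hw a
        exact ⟨b, hI (w.injective ((he b).1.symm.trans hb))⟩
    exact ⟨w, Equiv.ofBijective e hbij, fun b => (he b).1, fun b => (he b).2⟩
  · rintro ⟨w, e, h1, h2⟩
    obtain rfl : k' = k := by simpa using Fintype.card_congr e
    have hW : ∀ x : Fin n, w.extendDomain Fin.equivSubtype x = (w x : ℕ) := fun x =>
      w.extendDomain_apply_image Fin.equivSubtype x
    have h1' : ∀ a, (I' a : ℕ) = w.extendDomain Fin.equivSubtype (I (e a)) := fun a => by
      rw [hW, h1]
    have h2' : ∀ a, (J' a : ℕ) = w.extendDomain Fin.equivSubtype (J (e a)) := fun a => by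
      rw [hW, h2]
    unfold cyclePart pathPart
    rw [cycleMult_conj vI vI' h1' h2', pathMult_conj vI vI' h1' h2']
    exact ⟨rfl, rfl⟩

end PaperStmt
end

section
/- Let (I,J) be a packed partial permutation of size k with I ∪ J = [m], let λ be a partition of n, and fix π ∈ K_λ. Then (n)_m · E_λ[1_{IJ}] equals the number of injections φ : [m] ↪ [n] that are compatible with (I,J) relative to π, i.e. such that π(φ(i_ℓ)) = φ(j_ℓ) for all ℓ ∈ [k]. -/
open Finset Filter
open scoped Classical BigOperators

namespace PaperStmt

theorem mem_KClass_iff_isConj {n : ℕ} {lam : Nat.Partition n} {π : Equiv.Perm (Fin n)}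
    (hπ : π ∈ KClass lam) (τ : Equiv.Perm (Fin n)) : τ ∈ KClass lam ↔ IsConj π τ := by
  have key (σ : Equiv.Perm (Fin n)) : fullCycleType σ = σ.partition.parts := by
    rw [Equiv.Perm.parts_partition, fullCycleType, Fintype.card_fin]
  simp only [KClass, mem_filter, mem_univ, true_and, key] at hπ ⊢
  rw [← hπ, Equiv.Perm.partition_eq_of_isConj]
  constructor
  · intro h
    exact Nat.Partition.ext h.symm
  · intro h
    rw [h]

theorem conj_mem_KClass_iff {n : ℕ} {lam : Nat.Partition n} (g τ : Equiv.Perm (Fin n)) :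
    g * τ * g⁻¹ ∈ KClass lam ↔ τ ∈ KClass lam := by
  constructor <;> intro h
  · exact (mem_KClass_iff_isConj h τ).2 (isConj_iff.2 ⟨g, rfl⟩).symm
  · exact (mem_KClass_iff_isConj h _).2 (isConj_iff.2 ⟨g, rfl⟩)

/-- The embedding `φ` is compatible with the partial permutation `(U,V)` relative to `τ`. -/
def IsCompatible {n m k : ℕ} (U V : Fin k → Fin m) (φ : Fin m ↪ Fin n)
    (τ : Equiv.Perm (Fin n)) : Prop :=
  ∀ ℓ, τ (φ (U ℓ)) = φ (V ℓ)

theorem isCompatible_conj_iff {n m k : ℕ} (U V : Fin k → Fin m) (φ : Fin m ↪ Fin n)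
    (g τ : Equiv.Perm (Fin n)) :
    IsCompatible U V (g • φ) (g * τ * g⁻¹) ↔ IsCompatible U V φ τ := by
  simp [IsCompatible, Function.Embedding.smul_apply]

theorem card_compatible_embeddings_eq {n m k : ℕ} (U V : Fin k → Fin m) {lam : Nat.Partition n}
    {π τ : Equiv.Perm (Fin n)} (hπ : π ∈ KClass lam) (hτ : τ ∈ KClass lam) :
    (univ.filter fun φ : Fin m ↪ Fin n => IsCompatible U V φ τ).card =
      (univ.filter fun φ : Fin m ↪ Fin n => IsCompatible U V φ π).card := by
  obtain ⟨g, rfl⟩ := isConj_iff.1 ((mem_KClass_iff_isConj hπ τ).1 hτ)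
  refine (card_equiv (MulAction.toPerm g) fun φ => ?_).symm
  simp [isCompatible_conj_iff]

theorem card_compatible_perms_eq {n m k : ℕ} (U V : Fin k → Fin m) (lam : Nat.Partition n)
    (φ ψ : Fin m ↪ Fin n) :
    ((KClass lam).filter fun τ => IsCompatible U V φ τ).card =
      ((KClass lam).filter fun τ => IsCompatible U V ψ τ).card := by
  have := Equiv.Perm.isMultiplyPretransitive (Fin n) m
  obtain ⟨g, rfl⟩ := MulAction.exists_smul_eq (Equiv.Perm (Fin n)) φ ψ
  refine card_equiv (MulAut.conj g).toEquiv fun τ => ?_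
  simp [isCompatible_conj_iff, conj_mem_KClass_iff]

theorem card_embeddings_filter {n m : ℕ} (P : (Fin m → Fin n) → Prop) :
    (univ.filter fun φ : Fin m ↪ Fin n => P φ).card =
      (univ.filter fun φ : Fin m → Fin n => Function.Injective φ ∧ P φ).card := by
  refine card_bij (fun φ _ => φ) ?_ (fun _ _ _ _ h => DFunLike.coe_injective h) ?_
  · intro φ hφ
    simpa [φ.injective] using hφ
  · intro φ hφ
    simp only [mem_filter, mem_univ, true_and] at hφ
    exact ⟨⟨φ, hφ.1⟩, by simpa using hφ.2, rfl⟩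

theorem descFactorial_mul_card_compatible {n m k : ℕ} (U V : Fin k → Fin m)
    {lam : Nat.Partition n} {π : Equiv.Perm (Fin n)} (hπ : π ∈ KClass lam) (ψ : Fin m ↪ Fin n) :
    n.descFactorial m * ((KClass lam).filter fun τ => IsCompatible U V ψ τ).card =
      (KClass lam).card * (univ.filter fun φ : Fin m ↪ Fin n => IsCompatible U V φ π).card := by
  have h := sum_card_bipartiteAbove_eq_sum_card_bipartiteBelow
    (s := (univ : Finset (Fin m ↪ Fin n))) (t := KClass lam) (IsCompatible U V)
  simp only [bipartiteAbove, bipartiteBelow] at h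
  rw [sum_congr rfl fun φ _ => card_compatible_perms_eq U V lam φ ψ,
    sum_congr rfl fun τ hτ => card_compatible_embeddings_eq U V hπ hτ] at h
  simpa [Fintype.card_embedding_eq] using h

/-- Equation `eq:reformulation`.  For a packed partial permutation `(I,J)`
of size `k` with `I ∪ J = [m]`, a partition `λ ⊢ n` and any fixed `π ∈ K_λ`,
`(n)_m ⬝ E_λ[1_{IJ}]` equals the number of injections `φ : [m] ↪ [n]` compatible with `(I,J)`
relative to `π`. -/
theorem statement2 {n m k : ℕ} (hmn : m ≤ n) (U V : Fin k → Fin m)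
    (hU : Function.Injective U) (hV : Function.Injective V)
    (packed : Finset.image U Finset.univ ∪ Finset.image V Finset.univ = Finset.univ)
    (lam : Nat.Partition n) (π : Equiv.Perm (Fin n)) (hπ : π ∈ KClass lam) :
    (n.descFactorial m : ℝ) *
        expect lam (indic (Fin.castLE hmn ∘ U) (Fin.castLE hmn ∘ V)) =
      ((Finset.univ.filter fun φ : Fin m → Fin n =>
          Function.Injective φ ∧ ∀ ℓ, π (φ (U ℓ)) = φ (V ℓ)).card : ℝ) := by
  have hcard : ((KClass lam).card : ℝ) ≠ 0 := by
    exact_mod_cast (card_pos.2 ⟨π, hπ⟩).ne'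
  have hsum : ∑ τ ∈ KClass lam, indic (Fin.castLE hmn ∘ U) (Fin.castLE hmn ∘ V) τ =
      (((KClass lam).filter fun τ => IsCompatible U V (Fin.castLEEmb hmn) τ).card : ℝ) := by
    simp [indic, IsCompatible]
  have h := descFactorial_mul_card_compatible U V hπ (Fin.castLEEmb hmn)
  have hcount : (univ.filter fun φ : Fin m → Fin n =>
      Function.Injective φ ∧ ∀ ℓ, π (φ (U ℓ)) = φ (V ℓ)).card =
      (univ.filter fun φ : Fin m ↪ Fin n => IsCompatible U V φ π).card := by
    convert (card_embeddings_filter fun φ : Fin m → Fin n => ∀ ℓ, π (φ (U ℓ)) = φ (V ℓ)).symm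
    rfl
  rw [hcount, expect, hsum, ← mul_div_assoc,
    div_eq_iff hcard, mul_comm (Nat.cast (card _)) (Nat.cast (card (KClass lam)))]
  exact_mod_cast h

end PaperStmt
end

section
/- Let Ψ be a regular permutation statistic of power p. Then there exists a polynomial f ∈ ℝ[x], depending only on Ψ, such that for every α ∈ [0,1] and every sequence {λ^{(n)}} with λ^{(n)} a partition of n and lim_{n→∞} m_1(λ^{(n)})/n = α, one has lim_{n→∞} E_{λ^{(n)}}[Ψ/n^p] = f(α). -/
open Finset Filter
open scoped Classical BigOperators

namespace PaperStmt

variable (R : Type) [CommRing R]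

/-- The data of a constrained translate `T^f_{(U,V),C}`: a packed partial permutation `(U,V)`
of size `k` with `U ∪ V = [m]`, a set `C ⊆ [m-1]` of vincular constraints, and a polynomial
weight `f ∈ R[x_1,…,x_m]`. -/
structure TranslateData where
  k : ℕ
  m : ℕ
  U : Fin k → Fin m
  V : Fin k → Fin m
  injU : Function.Injective U
  injV : Function.Injective V
  packed : Finset.image U Finset.univ ∪ Finset.image V Finset.univ = Finset.univ
  C : Finset ℕ
  hC : ∀ c ∈ C, c + 1 < m

  f : MvPolynomial (Fin m) R

variable {R}

/-- The value of the constrained translate `T^f_{(U,V),C}` on a permutation in `S_n`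
(only the `C`-constrained `m`-element subsets `L ⊆ [n]` contribute). -/
noncomputable def TranslateData.eval (T : TranslateData R) (n : ℕ)
    (π : Equiv.Perm (Fin n)) : R :=
  ∑ s ∈ Finset.univ.filter (fun s : Fin T.m → Fin n =>
      StrictMono s ∧ ∀ c ∈ T.C, ∀ h : c + 1 < T.m,
        (s ⟨c + 1, h⟩ : ℕ) = (s ⟨c, Nat.lt_of_succ_lt h⟩ : ℕ) + 1),
    MvPolynomial.eval (fun i => ((s i : ℕ) : R)) T.f *
      (if ∀ ℓ, π (s (T.U ℓ)) = s (T.V ℓ) then 1 else 0)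

/-- The size of a constrained translate. -/
def TranslateData.size (T : TranslateData R) : ℕ := T.k

/-- The shift of a constrained translate. -/
def TranslateData.shift (T : TranslateData R) : ℕ := T.C.card

/-- The power of a constrained translate. -/
def TranslateData.power (T : TranslateData R) : ℤ :=
  (T.k : ℤ) + T.f.totalDegree - T.C.card

/-- `Ψ` is a regular statistic which can be written as a linear combination of constrained
translates, each of size at most `k`, shift at most `q` and power at most `p`.  (In
particular, a regular statistic of size `k`, shift `q` and power `p` — these being the minima
over all expansions — satisfies this.) -/
def IsRegularOfSSP (Ψ : ∀ n, Equiv.Perm (Fin n) → R) (k q : ℕ) (p : ℤ) : Prop :=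
  ∃ (N : ℕ) (c : Fin N → R) (T : Fin N → TranslateData R),
    (∀ i, (T i).size ≤ k ∧ (T i).shift ≤ q ∧ (T i).power ≤ p) ∧
    ∀ (n : ℕ) (π : Equiv.Perm (Fin n)), Ψ n π = ∑ i, c i * (T i).eval n π

/-- Transfer-matrix weights of chains whose steps from position `i` to `i + 1` are weighted
by `w i`. -/
noncomputable def chainWeight (f : ℕ → ℝ) (w : ℕ → ℕ → ℕ → ℝ) (N : ℕ) : ℕ → ℕ → ℝ
  | 0, t => f t
  | i + 1, t => ∑ u : Fin N, chainWeight f w N i u * w i u t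

theorem sum_chain_eq_sum_chainWeight (f : ℕ → ℝ) (w : ℕ → ℕ → ℕ → ℝ) (N m : ℕ) (h : ℕ → ℝ) :
    ∑ s : Fin (m + 1) → Fin N,
      f (s 0) * (∏ i : Fin m, w i (s i.castSucc) (s i.succ)) * h (s (Fin.last m)) =
      ∑ t : Fin N, chainWeight f w N m t * h t := by
  induction m generalizing h with
  | zero =>
    simp only [univ_eq_empty, prod_empty, mul_one, chainWeight]
    refine Fintype.sum_equiv (Equiv.funUnique (Fin 1) (Fin N)) _ _ fun s => ?_
    simp [Equiv.funUnique]
  | succ m ih =>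
    have key : ∀ t : Fin N, chainWeight f w N (m + 1) t * h t =
        ∑ s : Fin (m + 1) → Fin N,
          f (s 0) * (∏ i : Fin m, w i (s i.castSucc) (s i.succ)) *
            (w m (s (Fin.last m)) t * h t) := by
      intro t
      rw [ih (fun u => w m u t * h t), chainWeight, sum_mul]
      simp only [mul_assoc]
    simp only [key]
    rw [← Fintype.sum_prod_type']
    symm
    refine Fintype.sum_equiv (Fin.snocEquiv fun _ => Fin N) _ _ fun p => ?_
    rw [Fin.prod_univ_castSucc]
    have h0 : (Fin.snocEquiv fun _ : Fin (m + 2) => Fin N) p 0 = p.2 0 := by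
      exact Fin.snoc_castSucc (α := fun _ => Fin N) p.1 p.2 0
    have h1 : ∀ i : Fin (m + 1), (Fin.snocEquiv fun _ : Fin (m + 2) => Fin N) p i.castSucc = p.2 i :=
      fun i => Fin.snoc_castSucc (α := fun _ => Fin N) p.1 p.2 i
    have h2 : (Fin.snocEquiv fun _ : Fin (m + 2) => Fin N) p (Fin.last (m + 1)) = p.1 :=
      Fin.snoc_last (α := fun _ => Fin N) p.1 p.2
    simp only [Fin.succ_castSucc, h1, h0, Fin.succ_last, h2, Fin.val_castSucc, Fin.val_last]
    ring

theorem sum_range_descFactorial (n d : ℕ) :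
    (d + 1) * ∑ u ∈ range n, u.descFactorial d = n.descFactorial (d + 1) := by
  induction n with
  | zero => simp
  | succ n ih =>
    rw [sum_range_succ, mul_add, ih, Nat.succ_descFactorial_succ, Nat.descFactorial_succ,
      ← add_mul]
    rcases le_or_gt d n with h | h
    · congr 1; omega
    · simp [Nat.descFactorial_eq_zero_iff_lt.2 h]

theorem tendsto_descFactorial_div_pow (d : ℕ) :
    Tendsto (fun n : ℕ => (n.descFactorial d : ℝ) / (n : ℝ) ^ d) atTop (nhds 1) := by
  refine (Asymptotics.isEquivalent_iff_tendsto_one ?_).1 (isEquivalent_descFactorial d)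
  filter_upwards [eventually_gt_atTop 0] with n hn
  positivity

theorem tendsto_sum_range_div_pow {a : ℕ → ℝ} {d : ℕ} {c : ℝ}
    (ha : Tendsto (fun n : ℕ => a n / (n : ℝ) ^ d) atTop (nhds c)) :
    Tendsto (fun n : ℕ => (∑ u ∈ range n, a u) / (n : ℝ) ^ (d + 1)) atTop
      (nhds (c / (d + 1))) := by
  have hsum : ∀ n : ℕ, ∑ u ∈ range n, (u.descFactorial d : ℝ) =
      n.descFactorial (d + 1) / (d + 1) := by
    intro n
    rw [eq_div_iff (by positivity), mul_comm]
    exact_mod_cast sum_range_descFactorial n d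
  have hdf := tendsto_descFactorial_div_pow d
  have hdf' := tendsto_descFactorial_div_pow (d + 1)
  have hlittle : (fun n : ℕ => a n - c * n.descFactorial d) =o[atTop]
      fun n : ℕ => (n.descFactorial d : ℝ) := by
    refine Asymptotics.IsLittleO.trans_isBigO ?_ (isEquivalent_descFactorial d).symm.isBigO
    rw [Asymptotics.isLittleO_iff_tendsto']
    · have := ha.sub (hdf.const_mul c)
      simp only [mul_one, sub_self] at this
      refine this.congr fun n => ?_
      ring
    · filter_upwards [eventually_gt_atTop 0] with n hn h0
      exact absurd h0 (by positivity)
  have hinf : Tendsto (fun n : ℕ => ∑ u ∈ range n, (u.descFactorial d : ℝ)) atTop atTop := by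
    simp only [hsum]
    refine Tendsto.atTop_div_const (by positivity) ?_
    refine (isEquivalent_descFactorial (d + 1)).symm.tendsto_atTop ?_
    exact (tendsto_pow_atTop (by omega)).comp tendsto_natCast_atTop_atTop
  have hS := hlittle.sum_range (fun n => by positivity) hinf
  have hS' : Tendsto (fun n : ℕ => (∑ u ∈ range n, (a u - c * u.descFactorial d)) /
      (n : ℝ) ^ (d + 1)) atTop (nhds 0) := by
    refine Asymptotics.IsLittleO.tendsto_div_nhds_zero (hS.trans_isBigO ?_)
    simp only [hsum, div_eq_inv_mul]
    exact ((isEquivalent_descFactorial (d + 1)).isBigO).const_mul_left _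
  have := hS'.add (hdf'.const_mul (c / (d + 1)))
  simp only [mul_one, zero_add] at this
  refine this.congr fun n => ?_
  rw [sum_sub_distrib, ← mul_sum, hsum]
  ring

/-- The sum of `∏ i, (s i) ^ (e i)` over the increasing chains `s 0 < ⋯ < s i = t` of natural
numbers which satisfy the vincular constraints `C`. -/
noncomputable def vincularSum (C : Finset ℕ) (e : ℕ → ℕ) : ℕ → ℕ → ℝ
  | 0, t => (t : ℝ) ^ e 0
  | i + 1, t => (∑ u ∈ range t, vincularSum C e i u *
      if i ∈ C then (if t = u + 1 then 1 else 0) else 1) * (t : ℝ) ^ e (i + 1)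

theorem chainWeight_eq_vincularSum (C : Finset ℕ) (e : ℕ → ℕ) (N i t : ℕ) (ht : t < N) :
    chainWeight (fun t => (t : ℝ) ^ e 0) (fun i u t =>
      (if u < t ∧ (i ∈ C → t = u + 1) then 1 else 0) * (t : ℝ) ^ e (i + 1)) N i t =
      vincularSum C e i t := by
  induction i generalizing t with
  | zero => rfl
  | succ i ih =>
    rw [chainWeight, vincularSum, sum_mul,
      Fin.sum_univ_eq_sum_range (fun u => chainWeight (fun t => (t : ℝ) ^ e 0) (fun i u t =>
        (if u < t ∧ (i ∈ C → t = u + 1) then 1 else 0) * (t : ℝ) ^ e (i + 1)) N i u *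
        ((if u < t ∧ (i ∈ C → t = u + 1) then 1 else 0) * (t : ℝ) ^ e (i + 1)))]
    symm
    refine sum_subset_zero_on_sdiff (range_subset_range.2 ht.le) ?_ ?_
    · intro u hu
      rw [Finset.mem_sdiff, mem_range, mem_range] at hu
      simp [hu.2]
    · intro u hu
      rw [mem_range] at hu
      rw [ih u (hu.trans ht)]
      by_cases hi : i ∈ C <;> simp [hi, hu]

/-- The exponent of the growth of `vincularSum`. -/
def vincularDegree (C : Finset ℕ) (e : ℕ → ℕ) : ℕ → ℕ
  | 0 => e 0
  | i + 1 => vincularDegree C e i + (if i ∈ C then 0 else 1) + e (i + 1)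

theorem exists_tendsto_vincularSum (C : Finset ℕ) (e : ℕ → ℕ) (i : ℕ) :
    ∃ c : ℝ, Tendsto (fun n : ℕ => vincularSum C e i n / (n : ℝ) ^ vincularDegree C e i)
      atTop (nhds c) := by
  induction i with
  | zero =>
    refine ⟨1, tendsto_const_nhds.congr' ?_⟩
    filter_upwards [eventually_gt_atTop 0] with n hn
    rw [vincularSum, vincularDegree, div_self (by positivity)]
  | succ i ih =>
    obtain ⟨c, hc⟩ := ih
    by_cases hi : i ∈ C
    · refine ⟨c, ?_⟩
      rw [← tendsto_add_atTop_iff_nat 1]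
      have h1 : Tendsto (fun n : ℕ => ((n : ℝ) / (n + 1)) ^ vincularDegree C e i) atTop
          (nhds 1) := by
        simpa using (tendsto_natCast_div_add_atTop (1 : ℝ)).pow (vincularDegree C e i)
      have h2 := hc.mul h1
      rw [mul_one] at h2
      refine h2.congr' ?_
      filter_upwards [eventually_gt_atTop 0] with n hn
      rw [vincularSum, vincularDegree]
      simp only [hi, if_true, add_zero]
      rw [sum_range_succ, sum_eq_zero]
      · simp only [if_true, zero_add, mul_one, pow_add]
        have : (n : ℝ) ≠ 0 := by positivity
        push_cast
        have h3 : (n : ℝ) + 1 ≠ 0 := by positivity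
        rw [div_pow]
        field_simp
      · intro u hu
        rw [mem_range] at hu
        rw [if_neg (by omega), mul_zero]
    · refine ⟨_, (tendsto_sum_range_div_pow hc).congr' ?_⟩
      filter_upwards [eventually_gt_atTop 0] with n hn
      rw [vincularSum, vincularDegree]
      simp only [hi, if_false, mul_one]
      rw [pow_add _ (vincularDegree C e i + 1), mul_div_mul_right _ _ (by positivity)]

theorem vincularDegree_add_card_filter (C : Finset ℕ) (e : ℕ → ℕ) (i : ℕ) :
    vincularDegree C e i + #{c ∈ range i | c ∈ C} = i + ∑ j ∈ range (i + 1), e j := by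
  induction i with
  | zero => simp [vincularDegree]
  | succ i ih =>
    rw [vincularDegree, sum_range_succ _ (i + 1), range_add_one (n := i), filter_insert]
    rw [range_add_one] at ih
    by_cases hi : i ∈ C
    · rw [if_pos hi, if_pos hi, card_insert_of_notMem (by simp)]
      omega
    · rw [if_neg hi, if_neg hi]
      omega

/-- The `m`-tuples of elements of `Fin n` encoding `Binom_C([n], m)`. -/
noncomputable def vincularTuples (C : Finset ℕ) (m n : ℕ) : Finset (Fin m → Fin n) :=
  {s | StrictMono s ∧ ∀ c ∈ C, ∀ h : c + 1 < m,
    (s ⟨c + 1, h⟩ : ℕ) = (s ⟨c, Nat.lt_of_succ_lt h⟩ : ℕ) + 1}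

theorem sum_vincularTuples_prod_pow (C : Finset ℕ) (e : ℕ → ℕ) (m n : ℕ) :
    ∑ s ∈ vincularTuples C (m + 1) n, ∏ i, ((s i : ℕ) : ℝ) ^ e i =
      ∑ t ∈ range n, vincularSum C e m t := by
  have h := sum_chain_eq_sum_chainWeight (fun t => (t : ℝ) ^ e 0) (fun i u t =>
      (if u < t ∧ (i ∈ C → t = u + 1) then 1 else 0) * (t : ℝ) ^ e (i + 1)) n m (fun _ => 1)
  simp only [mul_one] at h
  rw [Finset.sum_congr rfl fun (t : Fin n) _ => chainWeight_eq_vincularSum C e n m t t.2,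
    Fin.sum_univ_eq_sum_range (vincularSum C e m)] at h
  rw [← h, vincularTuples, sum_filter]
  refine sum_congr rfl fun s _ => ?_
  rw [prod_mul_distrib, Finset.prod_ite_zero, Fin.prod_univ_succ]
  have hiff : (StrictMono s ∧ ∀ c ∈ C, ∀ h : c + 1 < m + 1,
      (s ⟨c + 1, h⟩ : ℕ) = (s ⟨c, Nat.lt_of_succ_lt h⟩ : ℕ) + 1) ↔
      ∀ i ∈ (univ : Finset (Fin m)), (s i.castSucc : ℕ) < s i.succ ∧
        ((i : ℕ) ∈ C → (s i.succ : ℕ) = s i.castSucc + 1) := by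
    rw [Fin.strictMono_iff_lt_succ]
    constructor
    · rintro ⟨h1, h2⟩ i -
      exact ⟨h1 i, fun hi => h2 i hi (by omega)⟩
    · intro h1
      exact ⟨fun i => (h1 i (mem_univ _)).1,
        fun c hc hcm => (h1 ⟨c, by omega⟩ (mem_univ _)).2 hc⟩
  simp only [hiff]
  split_ifs <;> simp

theorem exists_tendsto_sum_vincularTuples_prod_pow (C : Finset ℕ) (m : ℕ)
    (hC : ∀ c ∈ C, c + 1 < m) (e : Fin m → ℕ) :
    ∃ c : ℝ, Tendsto (fun n : ℕ => (∑ s ∈ vincularTuples C m n, ∏ i, ((s i : ℕ) : ℝ) ^ e i) /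
      (n : ℝ) ^ (m + ∑ i, e i - #C)) atTop (nhds c) := by
  cases m with
  | zero =>
    refine ⟨1, tendsto_const_nhds.congr fun n => ?_⟩
    have : C = ∅ := eq_empty_of_forall_notMem fun c hc => absurd (hC c hc) (by omega)
    subst this
    simp [vincularTuples, Subsingleton.strictMono]
  | succ m =>
    set e' : ℕ → ℕ := fun j => if h : j < m + 1 then e ⟨j, h⟩ else 0 with he'
    have hee : ∀ i : Fin (m + 1), e i = e' i := fun i => by simp [he', not_lt_of_ge i.is_le]
    obtain ⟨c, hc⟩ := exists_tendsto_vincularSum C e' m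
    refine ⟨_, (tendsto_sum_range_div_pow hc).congr fun n => ?_⟩
    simp only [hee]
    rw [sum_vincularTuples_prod_pow, Fin.sum_univ_eq_sum_range e']
    have h := vincularDegree_add_card_filter C e' m
    have hCf : {c ∈ range m | c ∈ C} = C := by
      ext c
      simp only [mem_filter, mem_range, and_iff_right_iff_imp]
      intro hc
      have := hC c hc
      omega
    rw [hCf] at h
    congr 2
    omega

theorem card_le_of_forall_add_one_lt {C : Finset ℕ} {m : ℕ} (hC : ∀ c ∈ C, c + 1 < m) :
    #C ≤ m := by
  simpa using card_le_card fun c hc => mem_range.2 (by have := hC c hc; omega : c < m)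

theorem tendsto_natCast_zpow_of_nonpos {d : ℤ} (hd : d ≤ 0) :
    ∃ c : ℝ, Tendsto (fun n : ℕ => (n : ℝ) ^ d) atTop (nhds c) := by
  obtain ⟨k, rfl⟩ : ∃ k : ℕ, d = -k := ⟨d.natAbs, by omega⟩
  rcases Nat.eq_zero_or_pos k with rfl | hk
  · exact ⟨1, by simp⟩
  · refine ⟨0, ?_⟩
    simp only [zpow_neg, zpow_natCast]
    exact ((tendsto_pow_atTop hk.ne').comp tendsto_natCast_atTop_atTop).inv_tendsto_atTop

theorem exists_tendsto_sum_vincularTuples_eval (C : Finset ℕ) (m : ℕ)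
    (hC : ∀ c ∈ C, c + 1 < m) (f : MvPolynomial (Fin m) ℝ) :
    ∃ c : ℝ, Tendsto (fun n : ℕ => (∑ s ∈ vincularTuples C m n,
      MvPolynomial.eval (fun i => ((s i : ℕ) : ℝ)) f) /
      (n : ℝ) ^ ((m : ℤ) + f.totalDegree - #C)) atTop (nhds c) := by
  have hmon : ∀ d ∈ f.support, ∃ c : ℝ, Tendsto (fun n : ℕ =>
      MvPolynomial.coeff d f * ((∑ s ∈ vincularTuples C m n, ∏ i, ((s i : ℕ) : ℝ) ^ d i) /
      (n : ℝ) ^ ((m : ℤ) + f.totalDegree - #C))) atTop (nhds c) := by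
    intro d hd
    have hdeg : ∑ i, d i ≤ f.totalDegree := by
      have := MvPolynomial.le_totalDegree hd
      rwa [Finsupp.sum_fintype _ _ fun _ => rfl] at this
    obtain ⟨c, hc⟩ := exists_tendsto_sum_vincularTuples_prod_pow C m hC d
    obtain ⟨c', hc'⟩ := tendsto_natCast_zpow_of_nonpos
      (d := (∑ i, d i : ℕ) - (f.totalDegree : ℤ)) (by omega)
    refine ⟨_, ((hc.mul hc').const_mul (MvPolynomial.coeff d f)).congr' ?_⟩
    filter_upwards [eventually_gt_atTop 0] with n hn
    have hn0 : (n : ℝ) ≠ 0 := by positivity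
    have hCm := card_le_of_forall_add_one_lt hC
    rw [← zpow_natCast, div_mul_eq_mul_div, mul_div_assoc, ← zpow_sub₀ hn0,
      div_eq_mul_inv _ ((n : ℝ) ^ (_ : ℤ)), ← zpow_neg]
    congr 3
    push_cast [Nat.cast_sub (show #C ≤ m + ∑ i, d i by omega)]
    ring
  choose! c hc using hmon
  refine ⟨_, (tendsto_finsetSum f.support hc).congr fun n => ?_⟩
  simp only [MvPolynomial.eval_eq', mul_div_assoc', ← sum_div]
  rw [sum_comm]
  simp only [mul_sum]

/-- The occurrences in `π` of the graph of the partial permutation `(U,V)`. -/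
noncomputable def occurrences {k m n : ℕ} (U V : Fin k → Fin m) (π : Equiv.Perm (Fin n)) :
    Finset (Fin m → Fin n) :=
  {s | Function.Injective s ∧ ∀ ℓ, π (s (U ℓ)) = s (V ℓ)}

theorem card_filter_apply_eq_mul_le {k n : ℕ} (φ : Fin n → Fin n) {i j : Fin k} (hij : i ≠ j) :
    #{t : Fin k → Fin n | t j = φ (t i)} * n ≤ n ^ k := by
  have h := card_le_card_of_injOn (s := ({t : Fin k → Fin n | t j = φ (t i)} : Finset _) ×ˢ
    (univ : Finset (Fin n))) (t := (univ : Finset (Fin k → Fin n)))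
    (fun p => Function.update p.1 j p.2) (fun _ _ => mem_coe.2 (mem_univ _)) ?_
  · simpa using h
  · rintro ⟨t, a⟩ ht ⟨t', a'⟩ ht' h
    simp only [coe_product, Set.mem_prod, mem_coe, mem_filter, mem_univ, true_and, and_true,
      coe_univ, Set.mem_univ] at ht ht'
    have hx : ∀ x, x ≠ j → t x = t' x := fun x hx => by
      simpa [hx] using congrFun h x
    have ha : a = a' := by simpa using congrFun h j
    refine Prod.ext (funext fun x => ?_) ha
    change t x = t' x
    by_cases hxj : x = j
    · subst hxj
      rw [ht, ht', hx i hij]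
    · exact hx x hxj

/-- The tuples of `Fin n` which are fixed by `π` exactly at the loops of the graph of `(U,V)`. -/
noncomputable def loopTuples {k m n : ℕ} (U V : Fin k → Fin m) (π : Equiv.Perm (Fin n)) :
    Finset (Fin k → Fin n) :=
  Fintype.piFinset fun ℓ => if U ℓ = V ℓ then univ.filter fun x => π x = x else univ.filter fun x => π x ≠ x

section occurrences

variable {k m n : ℕ} {U V : Fin k → Fin m}

theorem comp_injOn_occurrences
    (hp : Finset.image U Finset.univ ∪ Finset.image V Finset.univ = Finset.univ)
    (π : Equiv.Perm (Fin n)) :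
    Set.InjOn (fun s : Fin m → Fin n => s ∘ U) (occurrences U V π) := by
  intro s hs s' hs' h
  simp only [occurrences, coe_filter, mem_univ, true_and, Set.mem_ofPred_eq] at hs hs'
  have hU : ∀ ℓ, s (U ℓ) = s' (U ℓ) := fun ℓ => congrFun h ℓ
  funext x
  have hx := mem_univ x
  rw [← hp, mem_union, Finset.mem_image, Finset.mem_image] at hx
  rcases hx with ⟨ℓ, -, rfl⟩ | ⟨ℓ, -, rfl⟩
  · exact hU ℓ
  · rw [← hs.2, ← hs'.2, hU]

theorem card_occurrences_mul_le
    (hp : Finset.image U Finset.univ ∪ Finset.image V Finset.univ = Finset.univ)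
    (π : Equiv.Perm (Fin n)) {i j : Fin k} (hij : i ≠ j) (h : V i = U j) :
    #(occurrences U V π) * n ≤ n ^ k := by
  refine le_trans (Nat.mul_le_mul_right n ?_) (card_filter_apply_eq_mul_le π hij)
  refine card_le_card_of_injOn _ ?_ (comp_injOn_occurrences hp π)
  intro s hs
  simp only [occurrences, coe_filter, mem_univ, true_and, Set.mem_ofPred_eq] at hs ⊢
  simp only [Function.comp, ← h, hs.2]

theorem comp_mem_loopTuples (π : Equiv.Perm (Fin n)) {s : Fin m → Fin n}
    (hs : s ∈ occurrences U V π) : s ∘ U ∈ loopTuples U V π := by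
  simp only [occurrences, mem_filter, mem_univ, true_and] at hs
  rw [loopTuples, Fintype.mem_piFinset]
  intro ℓ
  split_ifs with h
  · simp [hs.2, ← h]
  · simp [hs.2, hs.1.eq_iff, Ne.symm h]

theorem exists_occurrence_of_mem_loopTuples (hU : Function.Injective U)
    (hV : Function.Injective V)
    (hp : Finset.image U Finset.univ ∪ Finset.image V Finset.univ = Finset.univ)
    (hUV : ∀ i j, V i = U j → i = j) (π : Equiv.Perm (Fin n)) {t : Fin k → Fin n}
    (ht : t ∈ loopTuples U V π) (h1 : ∀ i j, i ≠ j → t j ≠ t i)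
    (h2 : ∀ i j, i ≠ j → t j ≠ π (t i)) : ∃ s ∈ occurrences U V π, s ∘ U = t := by
  rw [loopTuples, Fintype.mem_piFinset] at ht
  have htf : ∀ ℓ, π (t ℓ) = t ℓ ↔ U ℓ = V ℓ := by
    intro ℓ
    have := ht ℓ
    split_ifs at this with h <;> simpa [h] using this
  have hcover : ∀ x, (∃ ℓ, U ℓ = x) ∨ ∃ ℓ, V ℓ = x := by
    intro x
    have hx := mem_univ x
    rw [← hp, mem_union, Finset.mem_image, Finset.mem_image] at hx
    simpa using hx
  have hex : ∀ x, ∃ y, (∀ ℓ, U ℓ = x → y = t ℓ) ∧ ∀ ℓ, V ℓ = x → y = π (t ℓ) := by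
    intro x
    by_cases hx : ∃ ℓ, U ℓ = x
    · obtain ⟨ℓ, rfl⟩ := hx
      refine ⟨t ℓ, fun ℓ' h => by rw [hU h], fun ℓ' h => ?_⟩
      obtain rfl := hUV _ _ h
      exact ((htf _).2 h.symm).symm
    · obtain ⟨ℓ, rfl⟩ := (hcover x).resolve_left hx
      exact ⟨π (t ℓ), fun ℓ' h => (hx ⟨ℓ', h⟩).elim, fun ℓ' h => by rw [hV h]⟩
  choose s hsU hsV using hex
  have hsU' : ∀ ℓ, s (U ℓ) = t ℓ := fun ℓ => hsU _ ℓ rfl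
  have hsV' : ∀ ℓ, s (V ℓ) = π (t ℓ) := fun ℓ => hsV _ ℓ rfl
  refine ⟨s, ?_, funext hsU'⟩
  simp only [occurrences, mem_filter, mem_univ, true_and]
  refine ⟨?_, fun ℓ => by rw [hsU', hsV']⟩
  have hmix : ∀ i j, s (U i) = s (V j) → U i = V j := by
    intro i j h
    rw [hsU', hsV'] at h
    by_cases hij : j = i
    · subst hij
      exact (htf _).1 h.symm
    · exact (h2 _ _ hij h).elim
  intro x y hxy
  rcases hcover x with ⟨i, rfl⟩ | ⟨i, rfl⟩ <;> rcases hcover y with ⟨j, rfl⟩ | ⟨j, rfl⟩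
  · rw [hsU', hsU'] at hxy
    by_contra hne
    exact h1 j i (fun h => hne (by rw [h])) hxy
  · exact hmix _ _ hxy
  · exact (hmix _ _ hxy.symm).symm
  · rw [hsV', hsV', π.injective.eq_iff] at hxy
    by_contra hne
    exact h1 j i (fun h => hne (by rw [h])) hxy

theorem card_occurrences_le_card_loopTuples
    (hp : Finset.image U Finset.univ ∪ Finset.image V Finset.univ = Finset.univ)
    (π : Equiv.Perm (Fin n)) : #(occurrences U V π) ≤ #(loopTuples U V π) :=
  card_le_card_of_injOn _ (fun _ hs => comp_mem_loopTuples π hs) (comp_injOn_occurrences hp π)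

theorem card_loopTuples_mul_le (hU : Function.Injective U) (hV : Function.Injective V)
    (hp : Finset.image U Finset.univ ∪ Finset.image V Finset.univ = Finset.univ)
    (hUV : ∀ i j, V i = U j → i = j) (π : Equiv.Perm (Fin n)) :
    #(loopTuples U V π) * n ≤ #(occurrences U V π) * n + 2 * k ^ 2 * n ^ k := by
  set P : Finset (Fin k × Fin k) := {p | p.1 ≠ p.2} with hP
  set B : (Fin n → Fin n) → Finset (Fin k → Fin n) := fun φ =>
    P.biUnion fun p => {t | t p.2 = φ (t p.1)} with hB
  have hBcard : ∀ φ, #(B φ) * n ≤ k ^ 2 * n ^ k := by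
    intro φ
    calc #(B φ) * n ≤ (∑ p ∈ P, #{t : Fin k → Fin n | t p.2 = φ (t p.1)}) * n :=
          Nat.mul_le_mul_right n card_biUnion_le
      _ = ∑ p ∈ P, #{t : Fin k → Fin n | t p.2 = φ (t p.1)} * n := sum_mul ..
      _ ≤ ∑ _p ∈ P, n ^ k := sum_le_sum fun p hp =>
          card_filter_apply_eq_mul_le φ (mem_filter.1 hp).2
      _ = #P * n ^ k := by rw [sum_const, smul_eq_mul]
      _ ≤ k ^ 2 * n ^ k := Nat.mul_le_mul_right _ ((card_le_univ P).trans_eq (by simp [sq]))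
  have hsub : loopTuples U V π ⊆ (occurrences U V π).image (fun s => s ∘ U) ∪ (B id ∪ B π) := by
    intro t ht
    by_contra hcon
    simp only [mem_union, not_or, hB, hP, Finset.mem_image, mem_biUnion, mem_filter, mem_univ,
      true_and, not_exists, not_and, id, Prod.forall] at hcon
    obtain ⟨hc, h1, h2⟩ := hcon
    obtain ⟨s, hs, hst⟩ := exists_occurrence_of_mem_loopTuples hU hV hp hUV π ht h1 h2
    exact hc s hs hst
  have hcard := (card_le_card hsub).trans ((card_union_le _ _).trans
    (add_le_add card_image_le (card_union_le _ _)))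
  have := Nat.mul_le_mul_right n hcard
  have h1 := hBcard id
  have h2 := hBcard π
  nlinarith

end occurrences

/-- The limit of the density of occurrences of `(U,V)`, as a function of the limiting proportion
of fixed points. -/
noncomputable def densityPoly {k m : ℕ} (U V : Fin k → Fin m) : Polynomial ℝ :=
  if ∀ i j, V i = U j → i = j then
    ∏ ℓ, if U ℓ = V ℓ then Polynomial.X else 1 - Polynomial.X
  else 0

theorem card_loopTuples {k m n : ℕ} (U V : Fin k → Fin m) (hn : n ≠ 0)
    (π : Equiv.Perm (Fin n)) :
    (#(loopTuples U V π) : ℝ) = (n : ℝ) ^ k *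
      (∏ ℓ, if U ℓ = V ℓ then Polynomial.X else 1 - Polynomial.X : Polynomial ℝ).eval
        ((#{x | π x = x} : ℝ) / n) := by
  have hn' : (n : ℝ) ≠ 0 := by positivity
  have hk : (n : ℝ) ^ k = ∏ _ℓ : Fin k, (n : ℝ) := by simp
  rw [loopTuples, Fintype.card_piFinset, Polynomial.eval_prod, hk, ← prod_mul_distrib,
    Nat.cast_prod]
  refine prod_congr rfl fun ℓ _ => ?_
  have hc : #{x | π x = x} + #{x | π x ≠ x} = n := by
    simpa using card_filter_add_card_filter_not (s := (univ : Finset (Fin n))) (fun x => π x = x)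
  have hc' : (#{x | π x = x} : ℝ) + #{x | π x ≠ x} = n := by exact_mod_cast hc
  split_ifs
  · simp only [Polynomial.eval_X]
    field_simp
  · simp only [Polynomial.eval_sub, Polynomial.eval_one, Polynomial.eval_X]
    rw [eq_sub_of_add_eq' hc']
    field_simp

theorem abs_card_occurrences_div_sub_le {k m n : ℕ} {U V : Fin k → Fin m} (hn : n ≠ 0)
    (hU : Function.Injective U) (hV : Function.Injective V)
    (hp : Finset.image U Finset.univ ∪ Finset.image V Finset.univ = Finset.univ)
    (π : Equiv.Perm (Fin n)) :
    |(#(occurrences U V π) : ℝ) / (n : ℝ) ^ k -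
      (densityPoly U V).eval ((#{x | π x = x} : ℝ) / n)| ≤ (2 * k ^ 2 + 1) / n := by
  have hn' : (0 : ℝ) < n := by positivity
  have hnk : (0 : ℝ) < (n : ℝ) ^ k := by positivity
  rw [densityPoly]
  split_ifs with h
  · have hL := card_loopTuples U V hn π
    set q := Polynomial.eval ((#{x | π x = x} : ℝ) / n)
      (∏ ℓ, if U ℓ = V ℓ then Polynomial.X else 1 - Polynomial.X)
    have h1 : (#(occurrences U V π) : ℝ) ≤ #(loopTuples U V π) := by
      exact_mod_cast card_occurrences_le_card_loopTuples hp π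
    have h2 : (#(loopTuples U V π) : ℝ) * n ≤ #(occurrences U V π) * n + 2 * k ^ 2 * n ^ k := by
      exact_mod_cast card_loopTuples_mul_le hU hV hp h π
    rw [hL] at h1 h2
    rw [abs_sub_comm, abs_of_nonneg (sub_nonneg.2 ((div_le_iff₀' hnk).2 h1)), le_div_iff₀ hn',
      ← mul_le_mul_iff_of_pos_left hnk]
    have : (n : ℝ) ^ k * ((q - #(occurrences U V π) / (n : ℝ) ^ k) * n) =
        n ^ k * q * n - #(occurrences U V π) * n := by
      field_simp
    rw [this]
    nlinarith
  · push Not at h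
    obtain ⟨i, j, hVU, hij⟩ := h
    have h1 : (#(occurrences U V π) : ℝ) * n ≤ n ^ k := by
      exact_mod_cast card_occurrences_mul_le hp π hij hVU
    rw [Polynomial.eval_zero, sub_zero, abs_of_nonneg (by positivity),
      div_le_div_iff₀ hnk hn']
    have : (0 : ℝ) ≤ 2 * k ^ 2 * n ^ k := by positivity
    linarith

theorem count_one_parts_of_mem_KClass {n : ℕ} {lam : Nat.Partition n} {π : Equiv.Perm (Fin n)}
    (hπ : π ∈ KClass lam) : Multiset.count 1 lam.parts = #{x | π x = x} := by
  rw [KClass, mem_filter] at hπ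
  rw [← hπ.2, fullCycleType, Multiset.count_add, Multiset.count_replicate_self,
    Multiset.count_eq_zero.2 fun h => absurd (Equiv.Perm.two_le_of_mem_cycleType h) (by omega)]
  have h1 : #{x | π x = x} + #{x | π x ≠ x} = n := by
    simpa using card_filter_add_card_filter_not (s := (univ : Finset (Fin n))) (fun x => π x = x)
  have h2 : #π.support = #{x | π x ≠ x} := by
    congr 1
  omega

theorem KClass_nonempty {n : ℕ} (lam : Nat.Partition n) : (KClass lam).Nonempty := by
  have hsplit := Multiset.filter_add_not (fun a => 2 ≤ a) lam.parts
  have hone : lam.parts.filter (fun a => ¬ 2 ≤ a) =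
      Multiset.replicate (Multiset.card (lam.parts.filter fun a => ¬ 2 ≤ a)) 1 := by
    refine Multiset.eq_replicate_card.2 fun a ha => ?_
    rw [Multiset.mem_filter] at ha
    have := lam.parts_pos ha.1
    omega
  have hsum := congrArg Multiset.sum hsplit
  rw [Multiset.sum_add, lam.parts_sum, hone, Multiset.sum_replicate, smul_eq_mul, mul_one] at hsum
  obtain ⟨g, hg⟩ := (Equiv.Perm.exists_with_cycleType_iff (Fin n)
    (m := lam.parts.filter fun a => 2 ≤ a)).2
    ⟨by rw [Fintype.card_fin]; omega, fun a ha => (Multiset.mem_filter.1 ha).2⟩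
  refine ⟨g, ?_⟩
  rw [KClass, mem_filter]
  refine ⟨mem_univ _, ?_⟩
  have hsupp := Equiv.Perm.sum_cycleType g
  rw [hg] at hsupp
  rw [fullCycleType, hg, ← hsupp]
  conv_rhs => rw [← hsplit, hone]
  congr 2
  omega

theorem fullCycleType_conj {n : ℕ} (σ π : Equiv.Perm (Fin n)) :
    fullCycleType (σ * π * σ⁻¹) = fullCycleType π := by
  rw [fullCycleType, fullCycleType, ← Equiv.Perm.sum_cycleType, ← Equiv.Perm.sum_cycleType,
    Equiv.Perm.cycleType_conj]

theorem card_filter_KClass_eq {k m n : ℕ} (lam : Nat.Partition n) (U V : Fin k → Fin m)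
    {s s' : Fin m → Fin n} (hs : Function.Injective s) (hs' : Function.Injective s') :
    #{π ∈ KClass lam | ∀ ℓ, π (s (U ℓ)) = s (V ℓ)} =
      #{π ∈ KClass lam | ∀ ℓ, π (s' (U ℓ)) = s' (V ℓ)} := by
  obtain ⟨σ, hσ⟩ := Equiv.Perm.exists_extending_pair s s' hs hs'
  refine card_equiv (MulAut.conj σ).toEquiv fun π => ?_
  simp [KClass, fullCycleType_conj, ← hσ]

theorem sum_card_occurrences {k m n : ℕ} (lam : Nat.Partition n) (U V : Fin k → Fin m)
    {s : Fin m → Fin n} (hs : Function.Injective s) :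
    ∑ π ∈ KClass lam, #(occurrences U V π) =
      n.descFactorial m * #{π ∈ KClass lam | ∀ ℓ, π (s (U ℓ)) = s (V ℓ)} := by
  have hcard : #{s : Fin m → Fin n | Function.Injective s} = n.descFactorial m := by
    rw [← Fintype.card_subtype, Fintype.card_congr (Equiv.subtypeInjectiveEquivEmbedding _ _),
      Fintype.card_embedding_eq, Fintype.card_fin, Fintype.card_fin]
  have hocc : ∀ π : Equiv.Perm (Fin n), #(occurrences U V π) =
      ∑ s' : Fin m → Fin n with Function.Injective s',
        if ∀ ℓ, π (s' (U ℓ)) = s' (V ℓ) then 1 else 0 := by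
    intro π
    rw [occurrences, ← filter_filter, card_filter]
  simp only [hocc]
  rw [sum_comm, ← hcard, ← smul_eq_mul, ← sum_const]
  refine sum_congr rfl fun s' hs' => ?_
  rw [← card_filter, card_filter_KClass_eq lam U V (mem_filter.1 hs').2 hs]

theorem expect_finset_sum {n : ℕ} (lam : Nat.Partition n) {ι : Type*} (A : Finset ι) (c : ι → ℝ)
    (g : ι → Equiv.Perm (Fin n) → ℝ) :
    expect lam (fun π => ∑ i ∈ A, c i * g i π) = ∑ i ∈ A, c i * expect lam (g i) := by
  simp only [expect]
  rw [sum_comm, sum_div]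
  exact sum_congr rfl fun i _ => by rw [← mul_sum, mul_div_assoc]

theorem expect_div_const {n : ℕ} (lam : Nat.Partition n) (g : Equiv.Perm (Fin n) → ℝ) (c : ℝ) :
    expect lam (fun π => g π / c) = expect lam g / c := by
  rw [expect, expect, ← sum_div, div_right_comm]

theorem expect_indicator {k m n : ℕ} (lam : Nat.Partition n) (U V : Fin k → Fin m)
    {s : Fin m → Fin n} (hs : Function.Injective s) :
    expect lam (fun π => if ∀ ℓ, π (s (U ℓ)) = s (V ℓ) then 1 else 0) =
      expect lam (fun π => (#(occurrences U V π) : ℝ)) / n.descFactorial m := by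
  have hmn : m ≤ n := by simpa using Fintype.card_le_of_injective s hs
  have h0 : (n.descFactorial m : ℝ) ≠ 0 := by
    exact_mod_cast (Nat.descFactorial_pos.2 hmn).ne'
  have h1 := sum_card_occurrences lam U V hs
  rw [expect, expect, ← Nat.cast_sum, h1, sum_boole]
  push_cast
  field_simp

theorem abs_expect_sub_le {n : ℕ} (lam : Nat.Partition n) {g : Equiv.Perm (Fin n) → ℝ} {a ε : ℝ}
    (h : ∀ π ∈ KClass lam, |g π - a| ≤ ε) : |expect lam g - a| ≤ ε := by
  have hK : (0 : ℝ) < #(KClass lam) := by exact_mod_cast (KClass_nonempty lam).card_pos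
  have h1 : expect lam g - a = (∑ π ∈ KClass lam, (g π - a)) / #(KClass lam) := by
    rw [expect, sum_sub_distrib, sum_const, nsmul_eq_mul]
    field_simp
  rw [h1, abs_div, abs_of_pos hK, div_le_iff₀ hK, mul_comm, ← nsmul_eq_mul]
  exact (abs_sum_le_sum_abs _ _).trans (sum_le_card_nsmul _ _ _ h)

theorem tendsto_expect_card_occurrences {k m : ℕ} {U V : Fin k → Fin m}
    (hU : Function.Injective U) (hV : Function.Injective V)
    (hp : Finset.image U Finset.univ ∪ Finset.image V Finset.univ = Finset.univ)
    {α : ℝ} {lam : (n : ℕ) → Nat.Partition n}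
    (hα : Tendsto (fun n : ℕ => (Multiset.count 1 (lam n).parts : ℝ) / n) atTop (nhds α)) :
    Tendsto (fun n : ℕ => expect (lam n) (fun π => (#(occurrences U V π) : ℝ)) / (n : ℝ) ^ k)
      atTop (nhds ((densityPoly U V).eval α)) := by
  have hq := ((densityPoly U V).continuous.tendsto α).comp hα
  have hb : Tendsto (fun n : ℕ => (2 * (k : ℝ) ^ 2 + 1) / n) atTop (nhds 0) :=
    tendsto_const_div_atTop_nhds_zero_nat _
  have hdiff : Tendsto (fun n : ℕ =>
      expect (lam n) (fun π => (#(occurrences U V π) : ℝ)) / (n : ℝ) ^ k -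
        (densityPoly U V).eval ((Multiset.count 1 (lam n).parts : ℝ) / n)) atTop (nhds 0) := by
    refine squeeze_zero_norm' ?_ hb
    filter_upwards [eventually_gt_atTop 0] with n hn
    rw [← expect_div_const, Real.norm_eq_abs]
    refine abs_expect_sub_le _ fun π hπ => ?_
    rw [count_one_parts_of_mem_KClass hπ]
    exact abs_card_occurrences_div_sub_le hn.ne' hU hV hp π
  simpa using hdiff.add hq

theorem TranslateData.expect_eval (T : TranslateData ℝ) {n : ℕ} (lam : Nat.Partition n) :
    expect lam (T.eval n) =
      (∑ s ∈ vincularTuples T.C T.m n, MvPolynomial.eval (fun i => ((s i : ℕ) : ℝ)) T.f) *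
        (expect lam (fun π => (#(occurrences T.U T.V π) : ℝ)) / n.descFactorial T.m) := by
  have h : T.eval n = fun π => ∑ s ∈ vincularTuples T.C T.m n,
      MvPolynomial.eval (fun i => ((s i : ℕ) : ℝ)) T.f *
        (if ∀ ℓ, π (s (T.U ℓ)) = s (T.V ℓ) then 1 else 0) := rfl
  rw [h, expect_finset_sum, sum_mul]
  refine sum_congr rfl fun s hs => ?_
  rw [expect_indicator lam T.U T.V (mem_filter.1 hs).2.1.injective]

theorem TranslateData.exists_polynomial (T : TranslateData ℝ) {p : ℤ} (hT : T.power ≤ p) :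
    ∃ f : Polynomial ℝ, ∀ (α : ℝ) (lam : (n : ℕ) → Nat.Partition n),
      Tendsto (fun n : ℕ => (Multiset.count 1 (lam n).parts : ℝ) / n) atTop (nhds α) →
      Tendsto (fun n : ℕ => expect (lam n) (T.eval n) / (n : ℝ) ^ p) atTop
        (nhds (f.eval α)) := by
  obtain ⟨a, ha⟩ := exists_tendsto_sum_vincularTuples_eval T.C T.m T.hC T.f
  obtain ⟨b, hb⟩ := tendsto_natCast_zpow_of_nonpos (sub_nonpos.2 hT)
  refine ⟨Polynomial.C (a * b) * densityPoly T.U T.V, fun α lam hα => ?_⟩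
  have hocc := tendsto_expect_card_occurrences T.injU T.injV T.packed hα
  have h := ((ha.mul hb).mul hocc).div (tendsto_descFactorial_div_pow T.m) one_ne_zero
  rw [Polynomial.eval_mul, Polynomial.eval_C]
  rw [div_one] at h
  refine h.congr' ?_
  filter_upwards [eventually_gt_atTop 0] with n hn
  have hn0 : (n : ℝ) ≠ 0 := by positivity
  rw [Pi.div_apply, T.expect_eval, TranslateData.power]
  have hz : (n : ℝ) ^ ((T.k : ℤ) + T.f.totalDegree - #T.C - p) * (n : ℝ) ^ T.m * (n : ℝ) ^ p =
      (n : ℝ) ^ ((T.m : ℤ) + T.f.totalDegree - #T.C) * (n : ℝ) ^ T.k := by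
    rw [← zpow_natCast, ← zpow_natCast, ← zpow_add₀ hn0, ← zpow_add₀ hn0, ← zpow_add₀ hn0]
    congr 1
    ring
  have hz1 : (n : ℝ) ^ ((T.m : ℤ) + T.f.totalDegree - #T.C) ≠ 0 := zpow_ne_zero _ hn0
  have hz2 : (n : ℝ) ^ p ≠ 0 := zpow_ne_zero _ hn0
  generalize (n : ℝ) ^ ((T.k : ℤ) + T.f.totalDegree - #T.C - p) = x at *
  generalize (n : ℝ) ^ ((T.m : ℤ) + T.f.totalDegree - #T.C) = y at *
  generalize (n : ℝ) ^ p = z at *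
  have hx : x = y * (n : ℝ) ^ T.k / ((n : ℝ) ^ T.m * z) := by
    rw [eq_div_iff (by positivity), ← hz, mul_assoc]
  rw [hx]
  field_simp

/-- Corollary `expectation-fixed-point`.  If `Ψ` is a regular statistic of
power `p`, there is a polynomial `f ∈ ℝ[x]`, depending only on `Ψ`, such that for every
`α ∈ [0,1]` and every sequence `λ⁽ⁿ⁾ ⊢ n` with `m_1(λ⁽ⁿ⁾)/n → α`, one has
`E_{λ⁽ⁿ⁾}[Ψ/n^p] → f(α)`. -/
theorem statement14 (Ψ : ∀ n, Equiv.Perm (Fin n) → ℝ) (p : ℤ)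
    (hΨ : ∃ k q, IsRegularOfSSP Ψ k q p) :
    ∃ f : Polynomial ℝ, ∀ α : ℝ, α ∈ Set.Icc (0 : ℝ) 1 →
      ∀ lam : (n : ℕ) → Nat.Partition n,
        Filter.Tendsto (fun n : ℕ => (Multiset.count 1 (lam n).parts : ℝ) / n)
          Filter.atTop (nhds α) →
        Filter.Tendsto (fun n : ℕ => expect (lam n) (fun π => Ψ n π / (n : ℝ) ^ p))
          Filter.atTop (nhds (Polynomial.eval α f)) := by
  obtain ⟨k, q, N, c, T, hT, hΨ⟩ := hΨ
  choose f hf using fun i => (T i).exists_polynomial (hT i).2.2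
  refine ⟨∑ i, Polynomial.C (c i) * f i, fun α _ lam hα => ?_⟩
  have h := tendsto_finsetSum univ fun i _ => (hf i α lam hα).const_mul (c i)
  simp only [Polynomial.eval_finsetSum, Polynomial.eval_mul, Polynomial.eval_C]
  refine h.congr fun n => ?_
  simp only [hΨ]
  rw [expect_div_const, expect_finset_sum, sum_div]
  exact sum_congr rfl fun i _ => (mul_div_assoc _ _ _).symm

end PaperStmt
end
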